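/- arXiv:2006.13988 — 2 statements merged into one kernel-verified Lean document; each statement's English description precedes it below -/
import Mathlib

section
/- Let φ be the potential of the construction (φ=sup_n φ_n with constants c_n=−∑_{j=n}^∞ 1/(2^{j+1}β_j) and δ_j=(10+3 log₂ j)/(α j), 0<α<β_1), and let φ̄(x,z)=φ(x) on the pin-sequence space P. Then for any ergodic T̄-invariant probability measure μ̄ on P with μ̄(A)≠0: ∫φ̄ dμ̄ ≤ μ̄(A)·∑_{j=1}^∞ j( −q_j δ_j + ∑_{s=1}^{⌊log₂ j⌋−3} c_s q_{j,s} ), where q_j=μ̄_A(Q_j) and q_{j,s}=μ̄_A(Q_{j,s}). -/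
open MeasureTheory Real Filter Topology

noncomputable section

namespace PhaseTransitions

/-! ### Measure-theoretic entropy and topological pressure -/

/-- Base-2 entropy of the (finite, measurable) partition of `X` induced by an
observable `f : X → F` with finitely many values. -/
def entOfObs {X F : Type*} [MeasurableSpace X] [Fintype F]
    (μ : Measure X) (f : X → F) : ℝ :=
  ∑ a : F, -((μ (f ⁻¹' {a})).toReal * Real.logb 2 (μ (f ⁻¹' {a})).toReal)

/-- Entropy of the transformation `T` with respect to the partition induced by
the observable `f` : the limit (= infimum) of `(1/n) H(⋁_{i<n} T⁻ⁱ f)`. -/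
def entObsT {X F : Type*} [MeasurableSpace X] [Fintype F]
    (T : X → X) (μ : Measure X) (f : X → F) : ℝ :=
  ⨅ n : ℕ, entOfObs μ (fun x => fun i : Fin (n + 1) => f (T^[(i : ℕ)] x)) / (n + 1)

/-- Kolmogorov–Sinai (measure-theoretic) entropy, base 2: supremum over all
finite measurable partitions (encoded by observables with values in `Fin k`). -/
def kolSinai {X : Type*} [MeasurableSpace X] (T : X → X) (μ : Measure X) : ℝ :=
  ⨆ k : ℕ, ⨆ f : {f : X → Fin k // Measurable f}, entObsT T μ f.1

/-- `μ` is a `T`-invariant Borel probability measure. -/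
def InvProb {X : Type*} [MeasurableSpace X] (T : X → X) (μ : Measure X) : Prop :=
  IsProbabilityMeasure μ ∧ MeasurePreserving T μ μ

/-- Topological pressure, via the variational principle. -/
def pressure {X : Type*} [MeasurableSpace X] (T : X → X) (φ : X → ℝ) : ℝ :=
  ⨆ μ : {μ : Measure X // InvProb T μ}, (kolSinai T μ.1 + ∫ x, φ x ∂μ.1)

/-- An equilibrium state of the potential `φ`: an invariant probability measure
attaining the supremum in the variational principle. -/
def IsEquilibrium {X : Type*} [MeasurableSpace X] (T : X → X) (φ : X → ℝ)
    (μ : Measure X) : Prop :=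
  InvProb T μ ∧ kolSinai T μ + ∫ x, φ x ∂μ = pressure T φ

/-! ### The two-sided full shift on two symbols -/

/-- The two-sided full shift space `{0,1}^ℤ`. -/
abbrev Bin : Type := ℤ → Bool

/-- The (left) shift map. -/
def shift (x : Bin) : Bin := fun n => x (n + 1)

/-- `x` is a bi-infinite free concatenation of words from `W`: there is a
bi-infinite increasing sequence of cut points, cofinal in both directions, such
that consecutive cut points delimit words of `W`. -/
def IsFreeConcat (W : Set (List Bool)) (x : Bin) : Prop :=
  ∃ t : ℤ → ℤ, StrictMono t ∧ (∀ N : ℤ, ∃ k, N < t k) ∧ (∀ N : ℤ, ∃ k, t k < N) ∧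
    ∀ k : ℤ, ∃ w ∈ W, t (k + 1) = t k + w.length ∧
      ∀ (i : ℕ) (h : i < w.length), x (t k + (i : ℤ)) = w.get ⟨i, h⟩

/-- The coded system generated by the word set `W`: the closure of the set of
free concatenations of words from `W`. -/
def codedSystem (W : Set (List Bool)) : Set Bin :=
  closure {x | IsFreeConcat W x}

/-- The generating set `W_n = {0^{2^n-1}1, 1^{2^n-1}0}`. -/
def genWords (n : ℕ) : Set (List Bool) :=
  {List.replicate (2 ^ n - 1) false ++ [true], List.replicate (2 ^ n - 1) true ++ [false]}

/-- The subshift `X_n`, the coded system generated by `W_n`. -/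
def Xsub (n : ℕ) : Set Bin := codedSystem (genWords n)

/-- The set of words of length `j` in the language of `Y ⊆ {0,1}^ℤ`. -/
def langWord (Y : Set Bin) (j : ℕ) : Set (Fin j → Bool) :=
  {w | ∃ x ∈ Y, ∀ i : Fin j, x ((i : ℕ) : ℤ) = w i}

/-! ### The metric and the potential -/

open Classical in
/-- The metric `d(x,y) = 2^{-inf{|n| : x_n ≠ y_n}}` on the shift space. -/
def binDist (x y : Bin) : ℝ :=
  if x = y then 0
  else (1 / 2 : ℝ) ^ sInf {m : ℕ | ∃ i : ℤ, i.natAbs = m ∧ x i ≠ y i}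

/-- Distance from a point to a set. -/
def distToSet (x : Bin) (S : Set Bin) : ℝ :=
  sInf ((fun y => binDist x y) '' S)

/-- `δ_j = (10 + 3 log₂ j)/(α j)`. -/
def deltaSeq (α : ℝ) (j : ℕ) : ℝ := (10 + 3 * Real.logb 2 j) / (α * j)

/-- The drop `δ` as a function of the distance `r`: if `r = 2^{-j}` this equals
`δ_j = (10 + 3 log₂ j)/(α j)`, and `δ = 0` when `r = 0` (i.e. `δ_∞ = 0`). -/
def deltaOf (α : ℝ) (r : ℝ) : ℝ :=
  if r = 0 then 0
  else (10 + 3 * Real.logb 2 (-Real.logb 2 r)) / (α * (-Real.logb 2 r))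

/-- `c_n = -∑_{j=n}^∞ 1/(2^{j+1} β_j)`. -/
def cseq (β : ℕ → ℝ) (n : ℕ) : ℝ :=
  -∑' k : ℕ, 1 / (2 ^ (n + k + 1) * β (n + k))

/-- `φ_n(x) = c_n − δ_j` when `dist(x, X_n) = 2^{-j}` (and `φ_n = c_n` on `X_n`). -/
def phiN (α : ℝ) (c : ℕ → ℝ) (n : ℕ) (x : Bin) : ℝ :=
  c n - deltaOf α (distToSet x (Xsub n))

/-- The potential `φ = sup_{n ≥ 1} φ_n`. -/
def phi (α : ℝ) (c : ℕ → ℝ) (x : Bin) : ℝ :=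
  ⨆ n : ℕ, phiN α c (n + 1) x

/-- The constants of the finite (truncated) construction:
`c_{n} = c_1 + ∑_{j=1}^{n-1} 1/(2^{j+1} β_j)`. -/
def cseqFin (c1 : ℝ) (β : ℕ → ℝ) (n : ℕ) : ℝ :=
  c1 + ∑ j ∈ Finset.Ico 1 n, 1 / (2 ^ (j + 1) * β j)

/-- The truncated potential `φ = max{φ_n : 1 ≤ n ≤ N+1}`. -/
def phiFin (α : ℝ) (c : ℕ → ℝ) (N : ℕ) (x : Bin) : ℝ :=
  ⨆ n : Fin (N + 1), phiN α c ((n : ℕ) + 1) x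

/-! ### Measures of maximal entropy and relative pressure -/

/-- `μ` is a measure of maximal entropy for the subsystem `Y` (a `T`-invariant
probability measure giving full mass to `Y` and maximizing entropy among such). -/
def IsMaxEntropyOn (Y : Set Bin) (μ : Measure Bin) : Prop :=
  InvProb shift μ ∧ μ Y = 1 ∧
    ∀ ν : Measure Bin, InvProb shift ν → ν Y = 1 → kolSinai shift ν ≤ kolSinai shift μ

/-- The topological pressure of the subsystem `Y` (computed via the variational
principle over invariant measures giving full mass to `Y`). -/
def pressureOn (Y : Set Bin) (φ : Bin → ℝ) : ℝ :=
  ⨆ μ : {μ : Measure Bin // InvProb shift μ ∧ μ Y = 1},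
    (kolSinai shift μ.1 + ∫ x, φ x ∂μ.1)

/-! ### The pin-sequence space -/

/-- `Y`, the closure of the union of the `X_n`, `n ≥ 1`. -/
def Yset : Set Bin := closure (⋃ n : ℕ, Xsub (n + 1))

/-- The word `x_i ⋯ x_j` belongs to the language of `Y`. -/
def SegIn (x : Bin) (i j : ℤ) (Y : Set Bin) : Prop :=
  ∃ y ∈ Y, ∀ m : ℤ, i ≤ m → m ≤ j → y (m - i) = x m

/-- The word `x_0 ⋯ x_{j-1}` belongs to the language of `Y`. -/
def WordIn (x : Bin) (j : ℕ) (Y : Set Bin) : Prop :=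
  ∃ y ∈ Y, ∀ m : ℕ, m < j → y (m : ℤ) = x (m : ℤ)

/-- The pin-sequence space `P ⊆ X × {0,1}^ℤ`: pinless stretches of `x` lie in the
language of `Y`, and stretches between two pins do not. -/
def PinSpace : Set (Bin × Bin) :=
  {p | (∀ i j : ℤ, i < j → (∀ k : ℤ, i < k → k ≤ j → p.2 k = false) → SegIn p.1 i j Yset) ∧
       (∀ i j : ℤ, i < j → p.2 i = true → p.2 j = true → ¬ SegIn p.1 i j Yset)}

/-- The product shift `T̄(x,z) = (Tx, Tz)`. -/
def shift2 (p : Bin × Bin) : Bin × Bin := (shift p.1, shift p.2)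

/-- The set `A = {(x,z) ∈ P : z_0 = 1}`. -/
def Aset : Set (Bin × Bin) := {p | p ∈ PinSpace ∧ p.2 0 = true}

/-- The first return time to `A`. -/
def retTime (p : Bin × Bin) : ℕ :=
  sInf {k : ℕ | 1 ≤ k ∧ shift2^[k] p ∈ Aset}

/-- The induced (first-return) map `T̄_A`. -/
def inducedMap (p : Bin × Bin) : Bin × Bin := shift2^[retTime p] p

/-- `Q_j`, the set of points of `A` with first return time `j`. -/
def Qset (j : ℕ) : Set (Bin × Bin) := {p | p ∈ Aset ∧ retTime p = j}

/-- `Q_{j,s}` for `1 ≤ s ≤ ⌊log₂ j⌋ - 3`: points of `Q_j` whose initial block of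
length `j` lies in the language of `X_s`; the class `s = 0` collects the blocks
belonging to some `X_{s'}` with `s' ≥ ⌊log₂ j⌋ - 2`. -/
def Qjs (j s : ℕ) : Set (Bin × Bin) :=
  if s = 0 then
    {p | p ∈ Qset j ∧ ∃ s' : ℕ, 1 ≤ s' ∧ Nat.log 2 j - 2 ≤ s' ∧ WordIn p.1 j (Xsub s')}
  else {p | p ∈ Qset j ∧ WordIn p.1 j (Xsub s)}


/-! ### The structure of `X_n` -/

theorem isOpen_setOf_forall_eq (F : Finset ℤ) (y : Bin) :
    IsOpen {z : Bin | ∀ i ∈ F, z i = y i} := by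
  have h : {z : Bin | ∀ i ∈ F, z i = y i} = ⋂ i ∈ F, (fun z : Bin => z i) ⁻¹' {y i} := by
    ext z; simp
  rw [h]
  exact isOpen_biInter_finset fun i _ => (isOpen_discrete _).preimage (continuous_apply i)

theorem isOpen_of_local {U : Set Bin}
    (h : ∀ x ∈ U, ∃ F : Finset ℤ, ∀ z : Bin, (∀ i ∈ F, z i = x i) → z ∈ U) : IsOpen U := by
  rw [isOpen_iff_forall_mem_open]
  intro x hx
  obtain ⟨F, hF⟩ := h x hx
  exact ⟨_, fun z hz => hF z hz, isOpen_setOf_forall_eq F x, fun i _ => rfl⟩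

theorem exists_isFreeConcat_eqOn {W : Set (List Bool)} {y : Bin} (hy : y ∈ codedSystem W)
    (F : Finset ℤ) : ∃ z, IsFreeConcat W z ∧ ∀ i ∈ F, z i = y i := by
  obtain ⟨z, hz, hz'⟩ := mem_closure_iff.1 hy _ (isOpen_setOf_forall_eq F y) fun i _ => rfl
  exact ⟨z, hz', hz⟩

/-- `x` carries a word `b^{N-1} (1-b)` on the positions `r, …, r + N - 1`. -/
def IsBlock (N : ℤ) (x : Bin) (r : ℤ) : Prop :=
  ∃ b : Bool, (∀ i, r ≤ i → i < r + N - 1 → x i = b) ∧ x (r + N - 1) = !b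

theorem IsFreeConcat.exists_isBlock {n : ℕ} {x : Bin} (hx : IsFreeConcat (genWords n) x) (a : ℤ) :
    ∃ r, r ≤ a ∧ a < r + 2 ^ n ∧ IsBlock (2 ^ n) x r ∧ IsBlock (2 ^ n) x (r + 2 ^ n) := by
  obtain ⟨t, ht, hub, hlb, hw⟩ := hx
  have hpow : (1 : ℕ) ≤ 2 ^ n := Nat.one_le_two_pow
  have hpowz : ((2 ^ n : ℕ) : ℤ) = 2 ^ n := by push_cast; rfl
  have hblock : ∀ k, t (k + 1) = t k + 2 ^ n ∧ IsBlock (2 ^ n) x (t k) := by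
    intro k
    obtain ⟨w, hwW, hlen, hval⟩ := hw k
    have key : ∀ b : Bool, w = List.replicate (2 ^ n - 1) b ++ [!b] →
        t (k + 1) = t k + 2 ^ n ∧ IsBlock (2 ^ n) x (t k) := by
      rintro b rfl
      have hl : (List.replicate (2 ^ n - 1) b ++ [!b]).length = 2 ^ n := by simp; omega
      refine ⟨by rw [hlen, hl, hpowz], b, fun i h1 h2 => ?_, ?_⟩
      · obtain ⟨m, rfl⟩ : ∃ m : ℕ, i = t k + m := ⟨(i - t k).toNat, by omega⟩
        have hm : m < 2 ^ n - 1 := by omega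
        rw [hval m (by omega)]
        simp [hm]
      · have := hval (2 ^ n - 1) (by omega)
        rw [show t k + 2 ^ n - 1 = t k + ((2 ^ n - 1 : ℕ) : ℤ) by omega, this]
        simp
    rcases hwW with h | h
    · exact key false h
    · exact key true h
  obtain ⟨ku, hku⟩ := hub a
  obtain ⟨kl, hkl⟩ := hlb a
  obtain ⟨k, hk, hmax⟩ := Int.exists_greatest_of_bdd (P := fun k => t k ≤ a)
    ⟨ku, fun z hz => (ht.lt_iff_lt.1 (lt_of_le_of_lt hz hku)).le⟩ ⟨kl, hkl.le⟩
  refine ⟨t k, hk, ?_, (hblock k).2, ?_⟩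
  · rw [← (hblock k).1]
    by_contra! h
    have := hmax _ h
    omega
  · rw [← (hblock k).1]
    exact (hblock (k + 1)).2

/-- A point of `X_n` has no run of length `2^n + 1`. -/
theorem not_constant_of_mem_Xsub {s : ℕ} (hs : 1 ≤ s) {y : Bin} (hy : y ∈ Xsub s) (a : ℤ) (b : Bool)
    (h : ∀ i, a ≤ i → i ≤ a + 2 ^ s → y i = b) : False := by
  obtain ⟨z, hz, hzy⟩ := exists_isFreeConcat_eqOn hy (Finset.Icc a (a + 2 ^ s))
  have hc : ∀ i, a ≤ i → i ≤ a + 2 ^ s → z i = b := fun i h1 h2 => by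
    rw [hzy i (Finset.mem_Icc.2 ⟨h1, h2⟩), h i h1 h2]
  have hM : (2 : ℤ) ≤ 2 ^ s := by
    calc (2 : ℤ) = 2 ^ 1 := by norm_num
      _ ≤ 2 ^ s := pow_le_pow_right₀ (by norm_num) hs
  obtain ⟨r, h1, h2, ⟨c, hc1, hc2⟩, ⟨d, hd1, hd2⟩⟩ := hz.exists_isBlock a
  by_cases hr : a < r + 2 ^ s - 1
  · have e1 := hc1 a h1 hr
    rw [hc a le_rfl (by omega)] at e1
    rw [hc _ (by omega) (by omega)] at hc2
    simp_all
  · have e1 := hd1 (r + 2 ^ s) le_rfl (by omega)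
    rw [hc _ (by omega) (by omega)] at e1
    rw [hc _ (by omega) (by omega)] at hd2
    simp_all

/-- For `n > s`, every window of length `2^{s+1} + 2` of a point of `X_n` contains a run of
length `2^s + 1`. -/
theorem exists_constant_of_mem_Xsub {s n : ℕ} (hs : 1 ≤ s) (hn : s < n) {y : Bin}
    (hy : y ∈ Xsub n) (a : ℤ) :
    ∃ a' b, a ≤ a' ∧ a' + 2 ^ s < a + (2 * 2 ^ s + 2) ∧
      ∀ i, a' ≤ i → i ≤ a' + 2 ^ s → y i = b := by
  obtain ⟨z, hz, hzy⟩ := exists_isFreeConcat_eqOn hy (Finset.Icc a (a + (2 * 2 ^ s + 2)))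
  have hM : (2 : ℤ) ≤ 2 ^ s := by
    calc (2 : ℤ) = 2 ^ 1 := by norm_num
      _ ≤ 2 ^ s := pow_le_pow_right₀ (by norm_num) hs
  have hN : (2 : ℤ) * 2 ^ s ≤ 2 ^ n := by
    calc (2 : ℤ) * 2 ^ s = 2 ^ (s + 1) := by ring
      _ ≤ 2 ^ n := pow_le_pow_right₀ (by norm_num) hn
  obtain ⟨r, h1, h2, ⟨c, hc1, -⟩, ⟨d, hd1, -⟩⟩ := hz.exists_isBlock a
  by_cases hr : a + 2 ^ s < r + 2 ^ n - 1
  · refine ⟨a, c, le_rfl, by omega, fun i hi hi' => ?_⟩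
    rw [← hzy i (Finset.mem_Icc.2 ⟨by omega, by omega⟩)]
    exact hc1 i (by omega) (by omega)
  · refine ⟨r + 2 ^ n, d, by omega, by omega, fun i hi hi' => ?_⟩
    rw [← hzy i (Finset.mem_Icc.2 ⟨by omega, by omega⟩)]
    exact hd1 i (by omega) (by omega)

theorem IsFreeConcat.translate {W : Set (List Bool)} {x : Bin} (hx : IsFreeConcat W x) (a : ℤ) :
    IsFreeConcat W fun n => x (n + a) := by
  obtain ⟨t, ht, hub, hlb, hw⟩ := hx
  refine ⟨fun k => t k - a, fun k l h => sub_lt_sub_right (ht h) a, fun N => ?_, fun N => ?_,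
    fun k => ?_⟩
  · obtain ⟨k, hk⟩ := hub (N + a)
    exact ⟨k, by dsimp only; omega⟩
  · obtain ⟨k, hk⟩ := hlb (N + a)
    exact ⟨k, by dsimp only; omega⟩
  · obtain ⟨w, hwW, hlen, hval⟩ := hw k
    refine ⟨w, hwW, by dsimp only; omega, fun i h => ?_⟩
    rw [← hval i h]
    dsimp only
    ring_nf

theorem Xsub_translate {n : ℕ} {y : Bin} (hy : y ∈ Xsub n) (a : ℤ) :
    (fun m => y (m + a)) ∈ Xsub n := by
  have hc : Continuous fun (z : Bin) (m : ℤ) => z (m + a) :=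
    continuous_pi fun m => continuous_apply (m + a)
  exact map_mem_closure hc hy fun z hz => IsFreeConcat.translate hz a

theorem exists_mem_Xsub_apply_zero (n : ℕ) (hn : 1 ≤ n) (b : Bool) : ∃ y ∈ Xsub n, y 0 = b := by
  have hM : (2 : ℤ) ≤ 2 ^ n := by
    calc (2 : ℤ) = 2 ^ 1 := by norm_num
      _ ≤ 2 ^ n := pow_le_pow_right₀ (by norm_num) hn
  have hpow : (1 : ℕ) ≤ 2 ^ n := Nat.one_le_two_pow
  have hpowz : ((2 ^ n : ℕ) : ℤ) = 2 ^ n := by push_cast; rfl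
  refine ⟨fun k => if k % 2 ^ n = 2 ^ n - 1 then !b else b, subset_closure ?_, ?_⟩
  · refine ⟨fun k => 2 ^ n * k, fun k l h => by dsimp only; nlinarith, fun N => ⟨|N| + 1, ?_⟩,
      fun N => ⟨-(|N| + 1), ?_⟩, fun k => ?_⟩
    · dsimp only
      nlinarith [le_abs_self N, abs_nonneg N]
    · dsimp only
      nlinarith [neg_abs_le N, abs_nonneg N]
    · have hl : (List.replicate (2 ^ n - 1) b ++ [!b]).length = 2 ^ n := by simp; omega
      refine ⟨List.replicate (2 ^ n - 1) b ++ [!b], ?_, ?_, fun i hi => ?_⟩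
      · cases b <;> simp [genWords]
      · rw [hl, hpowz]; ring
      · rw [hl] at hi
        have hmod : (2 ^ n * k + (i : ℤ)) % 2 ^ n = i := by
          rw [Int.mul_add_emod_self_left]
          exact Int.emod_eq_of_lt (by omega) (by omega)
        dsimp only
        rw [hmod]
        by_cases h : i < 2 ^ n - 1
        · rw [if_neg (by omega)]
          simp [h]
        · rw [if_pos (by omega)]
          simp [List.getElem_append, h]
  · dsimp only
    rw [Int.zero_emod, if_neg (by omega)]

/-! ### The distance and the drop -/

theorem binDist_nonneg (x y : Bin) : 0 ≤ binDist x y := by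
  unfold binDist
  split_ifs
  · exact le_rfl
  · positivity

theorem pow_le_binDist {x y : Bin} {m : ℕ} (h : ∃ i : ℤ, i.natAbs ≤ m ∧ x i ≠ y i) :
    (1 / 2 : ℝ) ^ m ≤ binDist x y := by
  obtain ⟨i, hi, hne⟩ := h
  unfold binDist
  rw [if_neg fun h => hne (by rw [h])]
  have hmem : i.natAbs ∈ {m : ℕ | ∃ i : ℤ, i.natAbs = m ∧ x i ≠ y i} := ⟨i, rfl, hne⟩
  exact pow_le_pow_of_le_one (by norm_num) (by norm_num) ((Nat.sInf_le hmem).trans hi)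

theorem binDist_le_pow {x y : Bin} {m : ℕ} (h : ∀ i : ℤ, i.natAbs < m → x i = y i) :
    binDist x y ≤ (1 / 2 : ℝ) ^ m := by
  unfold binDist
  split_ifs with hxy
  · positivity
  · obtain ⟨i, hi⟩ := Function.ne_iff.1 hxy
    refine pow_le_pow_of_le_one (by norm_num) (by norm_num)
      (le_csInf ⟨_, i, rfl, hi⟩ ?_)
    rintro _ ⟨k, rfl, hk⟩
    by_contra! hlt
    exact hk (h k hlt)

theorem bddBelow_binDist (x : Bin) (S : Set Bin) : BddBelow ((fun y => binDist x y) '' S) :=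
  ⟨0, by rintro _ ⟨y, -, rfl⟩; exact binDist_nonneg x y⟩

theorem Xsub_nonempty {n : ℕ} (hn : 1 ≤ n) : (Xsub n).Nonempty :=
  let ⟨y, hy, _⟩ := exists_mem_Xsub_apply_zero n hn true
  ⟨y, hy⟩

theorem distToSet_nonneg (x : Bin) (S : Set Bin) : 0 ≤ distToSet x S :=
  Real.sInf_nonneg (by rintro _ ⟨y, -, rfl⟩; exact binDist_nonneg x y)

theorem distToSet_le_half {n : ℕ} (hn : 1 ≤ n) (x : Bin) : distToSet x (Xsub n) ≤ 1 / 2 := by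
  obtain ⟨y, hy, h0⟩ := exists_mem_Xsub_apply_zero n hn (x 0)
  refine (csInf_le (bddBelow_binDist x _) ⟨y, hy, rfl⟩).trans ?_
  have := binDist_le_pow (x := x) (y := y) (m := 1) fun i hi => by
    obtain rfl : i = 0 := by omega
    exact h0.symm
  simpa using this

theorem pow_le_distToSet {n : ℕ} (hn : 1 ≤ n) {x : Bin} {m : ℕ}
    (h : ∀ y ∈ Xsub n, ∃ i : ℤ, i.natAbs ≤ m ∧ x i ≠ y i) :
    (1 / 2 : ℝ) ^ m ≤ distToSet x (Xsub n) :=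
  le_csInf ((Xsub_nonempty hn).image _) (by rintro _ ⟨y, hy, rfl⟩; exact pow_le_binDist (h y hy))

theorem drop_antitone {α t u : ℝ} (hα : 0 < α) (ht : 1 ≤ t) (htu : t ≤ u) :
    (10 + 3 * Real.logb 2 u) / (α * u) ≤ (10 + 3 * Real.logb 2 t) / (α * t) := by
  have ht0 : 0 < t := by linarith
  have hu0 : 0 < u := by linarith
  have hl2 : (0.3 : ℝ) < Real.log 2 := by linarith [Real.log_two_gt_d9]
  have hlt : 0 ≤ Real.logb 2 t := Real.logb_nonneg (by norm_num) ht
  have hlog : Real.log (u / t) ≤ u / t - 1 := Real.log_le_sub_one_of_pos (by positivity)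
  have hsplit : Real.logb 2 u = Real.logb 2 t + Real.log (u / t) / Real.log 2 := by
    rw [Real.log_div hu0.ne' ht0.ne', Real.logb, Real.logb]
    ring
  have hq : 3 * t * (Real.log (u / t) / Real.log 2) ≤ 10 * (u - t) := by
    have h1 : t * Real.log (u / t) ≤ u - t := by
      calc t * Real.log (u / t) ≤ t * (u / t - 1) := by gcongr
        _ = u - t := by field_simp
    rw [← mul_div_assoc, div_le_iff₀ (by linarith)]
    nlinarith
  rw [div_le_div_iff₀ (by positivity) (by positivity), hsplit]
  have h2 : 0 ≤ Real.logb 2 t * (u - t) := mul_nonneg hlt (by linarith)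
  have h3 : (10 + 3 * (Real.logb 2 t + Real.log (u / t) / Real.log 2)) * t ≤
      (10 + 3 * Real.logb 2 t) * u := by linarith
  calc _ = α * ((10 + 3 * (Real.logb 2 t + Real.log (u / t) / Real.log 2)) * t) := by ring
    _ ≤ α * ((10 + 3 * Real.logb 2 t) * u) := by gcongr
    _ = _ := by ring

theorem one_le_neg_logb {r : ℝ} (h0 : 0 < r) (h1 : r ≤ 1 / 2) : 1 ≤ -Real.logb 2 r := by
  have : Real.logb 2 r ≤ -1 := by
    rw [Real.logb_le_iff_le_rpow (by norm_num) h0, Real.rpow_neg_one]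
    linarith
  linarith

theorem deltaSeq_le_deltaOf {α r : ℝ} {m : ℕ} (hα : 0 < α) (hr : (1 / 2 : ℝ) ^ m ≤ r)
    (h1 : r ≤ 1 / 2) : deltaSeq α m ≤ deltaOf α r := by
  have h0 : 0 < r := lt_of_lt_of_le (by positivity) hr
  have hm : -Real.logb 2 r ≤ m := by
    have : -(m : ℝ) ≤ Real.logb 2 r := by
      rw [Real.le_logb_iff_rpow_le (by norm_num) h0, Real.rpow_neg (by norm_num),
        Real.rpow_natCast]
      simpa using hr
    linarith
  unfold deltaSeq deltaOf
  rw [if_neg h0.ne']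
  exact drop_antitone hα (one_le_neg_logb h0 h1) hm

theorem deltaOf_nonneg {α r : ℝ} (hα : 0 < α) (h0 : 0 ≤ r) (h1 : r ≤ 1 / 2) :
    0 ≤ deltaOf α r := by
  unfold deltaOf
  split_ifs with h
  · exact le_rfl
  · have h2 := one_le_neg_logb (lt_of_le_of_ne h0 (Ne.symm h)) h1
    have h3 := Real.logb_nonneg (b := 2) (by norm_num) h2
    have h4 : 0 ≤ -Real.logb 2 r := by linarith
    positivity

theorem deltaOf_le {α r : ℝ} (hα : 0 < α) (h0 : 0 ≤ r) (h1 : r ≤ 1 / 2) :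
    deltaOf α r ≤ 10 / α := by
  unfold deltaOf
  split_ifs with h
  · positivity
  · have h2 := one_le_neg_logb (lt_of_le_of_ne h0 (Ne.symm h)) h1
    simpa using drop_antitone hα le_rfl h2

theorem deltaSeq_nonneg {α : ℝ} (hα : 0 < α) (j : ℕ) : 0 ≤ deltaSeq α j := by
  unfold deltaSeq
  have : 0 ≤ Real.logb 2 (j : ℝ) := by
    rcases Nat.eq_zero_or_pos j with rfl | h
    · simp
    · exact Real.logb_nonneg (by norm_num) (by exact_mod_cast h)
  positivity

theorem deltaSeq_antitone {α : ℝ} (hα : 0 < α) {i j : ℕ} (hi : 1 ≤ i) (hij : i ≤ j) :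
    deltaSeq α j ≤ deltaSeq α i :=
  drop_antitone hα (by exact_mod_cast hi) (by exact_mod_cast hij)

theorem deltaSeq_add_le {α : ℝ} (hα : 0 < α) {s j : ℕ} (hj : 2 ^ (s + 3) ≤ j) :
    deltaSeq α j + 1 / (2 ^ s * α) ≤ deltaSeq α (2 ^ (s + 2)) := by
  have hlog : ∀ k : ℕ, Real.logb 2 (((2 ^ k : ℕ)) : ℝ) = k := by
    intro k
    rw [Nat.cast_pow, Nat.cast_ofNat, Real.logb_pow, Real.logb_self_eq_one (by norm_num), mul_one]
  refine (add_le_add_left (deltaSeq_antitone hα Nat.one_le_two_pow hj) _).trans ?_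
  unfold deltaSeq
  rw [hlog, hlog]
  push_cast
  have hp : (0 : ℝ) < 2 ^ s := by positivity
  rw [pow_add, pow_add]
  generalize (2 : ℝ) ^ s = M at hp ⊢
  have h1 : (10 + 3 * ((s : ℝ) + 3)) / (α * (M * 2 ^ 3)) + 1 / (M * α) =
      (27 + 3 * s) / 8 / (α * M) := by
    field_simp
    ring
  have h2 : (10 + 3 * ((s : ℝ) + 2)) / (α * (M * 2 ^ 2)) = (16 + 3 * s) / 4 / (α * M) := by
    field_simp
    ring
  have h3 : (27 + 3 * (s : ℝ)) / 8 ≤ (16 + 3 * s) / 4 := by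
    linarith [(Nat.cast_nonneg s : (0 : ℝ) ≤ s)]
  rw [h1, h2]
  exact div_le_div_of_nonneg_right h3 (by positivity)

/-! ### The constants `c_n` -/

section Constants

variable {α : ℝ} {β : ℕ → ℝ}

theorem cseq_term_le (hα : 0 < α) (hβ : ∀ n, 1 ≤ n → α ≤ β n) {n : ℕ} (hn : 1 ≤ n) (k : ℕ) :
    0 ≤ 1 / (2 ^ (n + k + 1) * β (n + k)) ∧
      1 / (2 ^ (n + k + 1) * β (n + k)) ≤ 1 / (2 ^ n * α) / 2 / 2 ^ k := by
  have hb := hβ (n + k) (by omega)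
  have hb0 : 0 < β (n + k) := by linarith
  refine ⟨by positivity, ?_⟩
  rw [div_div, div_div]
  apply one_div_le_one_div_of_le (by positivity)
  calc 2 ^ n * α * (2 * 2 ^ k) = 2 ^ (n + k + 1) * α := by ring
    _ ≤ 2 ^ (n + k + 1) * β (n + k) := by gcongr

theorem cseq_summable (hα : 0 < α) (hβ : ∀ n, 1 ≤ n → α ≤ β n) {n : ℕ} (hn : 1 ≤ n) :
    Summable fun k : ℕ => 1 / (2 ^ (n + k + 1) * β (n + k)) :=
  Summable.of_nonneg_of_le (fun k => (cseq_term_le hα hβ hn k).1)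
    (fun k => (cseq_term_le hα hβ hn k).2) (summable_geometric_two' _)

theorem cseq_nonpos (hα : 0 < α) (hβ : ∀ n, 1 ≤ n → α ≤ β n) {n : ℕ} (hn : 1 ≤ n) :
    cseq β n ≤ 0 :=
  neg_nonpos.2 (tsum_nonneg fun k => (cseq_term_le hα hβ hn k).1)

theorem neg_cseq_le (hα : 0 < α) (hβ : ∀ n, 1 ≤ n → α ≤ β n) {n : ℕ} (hn : 1 ≤ n) :
    -cseq β n ≤ 1 / (2 ^ n * α) := by
  rw [cseq, neg_neg, ← tsum_geometric_two' (1 / (2 ^ n * α))]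
  exact (cseq_summable hα hβ hn).tsum_le_tsum (fun k => (cseq_term_le hα hβ hn k).2)
    (summable_geometric_two' _)

theorem cseq_mono (hα : 0 < α) (hβ : ∀ n, 1 ≤ n → α ≤ β n) {m n : ℕ} (hm : 1 ≤ m)
    (hmn : m ≤ n) : cseq β m ≤ cseq β n := by
  induction n, hmn using Nat.le_induction with
  | base => exact le_rfl
  | succ n hmn ih =>
    have hn : 1 ≤ n := hm.trans hmn
    refine ih.trans (neg_le_neg ?_)
    rw [(cseq_summable hα hβ hn).tsum_eq_zero_add]
    have h0 := (cseq_term_le hα hβ hn 0).1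
    have : ∀ k : ℕ, n + 1 + k = n + (k + 1) := fun k => by ring
    simp only [this]
    linarith

end Constants

/-! ### Pointwise bounds for the potential -/

/-- The simultaneous translate of both coordinates by `a`. -/
def translate (a : ℤ) (p : Bin × Bin) : Bin × Bin := (fun n => p.1 (n + a), fun n => p.2 (n + a))

theorem exists_ne_of_not_segIn {x : Bin} {j : ℕ} (hx : ¬ SegIn x 0 j Yset) {i : ℕ} (hi : i < j)
    {n : ℕ} (hn : 1 ≤ n) {y : Bin} (hy : y ∈ Xsub n) :
    ∃ k : ℤ, k.natAbs ≤ j ∧ x (k + i) ≠ y k := by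
  by_contra! h
  refine hx ⟨fun m => y (m + -(i : ℤ)), subset_closure (Set.mem_iUnion.2 ⟨n - 1, ?_⟩),
    fun m h1 h2 => ?_⟩
  · rw [Nat.sub_add_cancel hn]
    exact Xsub_translate hy (-i)
  · have := h (m - i) (by omega)
    rw [sub_add_cancel] at this
    simp [this, sub_eq_add_neg]

/-- A point of `X_n` differs from `x`, seen from any position of a block of `x` in the language of
`X_s`, at distance less than `2^{s+2}`. -/
theorem exists_ne_of_wordIn {x : Bin} {j s : ℕ} (hs : 1 ≤ s) (hj : 2 ^ (s + 3) ≤ j)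
    (hx : WordIn x j (Xsub s)) {i : ℕ} (hi : i < j) {n : ℕ} (hn : s < n) {y : Bin}
    (hy : y ∈ Xsub n) : ∃ k : ℤ, k.natAbs ≤ 2 ^ (s + 2) ∧ x (k + i) ≠ y k := by
  by_contra! h
  obtain ⟨w, hw, hwx⟩ := hx
  have hM : 2 ≤ 2 ^ s := by
    calc 2 = 2 ^ 1 := by norm_num
      _ ≤ 2 ^ s := Nat.pow_le_pow_right (by norm_num) hs
  have hMz : ((2 ^ s : ℕ) : ℤ) = 2 ^ s := by push_cast; rfl
  rw [pow_add] at hj h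
  obtain ⟨a, h1, h2, h3⟩ : ∃ a : ℤ, -(2 * 2 ^ s + 1) ≤ a ∧ a ≤ 0 ∧
      0 ≤ a + i ∧ a + i + (2 * 2 ^ s + 2) ≤ j := by
    by_cases hij : i + (2 * 2 ^ s + 2) ≤ j
    · exact ⟨0, by omega, le_rfl, by omega, by omega⟩
    · exact ⟨-(2 * 2 ^ s + 1), le_rfl, by omega, by omega, by omega⟩
  obtain ⟨a', b, h4, h5, h6⟩ := exists_constant_of_mem_Xsub hs hn hy a
  refine not_constant_of_mem_Xsub hs hw (a' + i) b fun k hk hk' => ?_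
  obtain ⟨m, rfl⟩ : ∃ m : ℕ, k = m := ⟨k.toNat, by omega⟩
  rw [hwx m (by omega), ← h6 (m - i) (by omega) (by omega), ← h (m - i) (by omega), sub_add_cancel]

theorem not_wordIn_of_lt {x : Bin} {j s t : ℕ} (hs : 1 ≤ s) (hst : s < t) (hj : 2 ^ (t + 3) ≤ j)
    (hxs : WordIn x j (Xsub s)) (hxt : WordIn x j (Xsub t)) : False := by
  obtain ⟨w, hw, hwx⟩ := hxt
  have hj' : 2 ^ (s + 3) ≤ j := (Nat.pow_le_pow_right (by norm_num) (by omega)).trans hj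
  have hM : 2 ≤ 2 ^ s := by
    calc 2 = 2 ^ 1 := by norm_num
      _ ≤ 2 ^ s := Nat.pow_le_pow_right (by norm_num) hs
  have hMz : ((2 ^ s : ℕ) : ℤ) = 2 ^ s := by push_cast; rfl
  rw [pow_add] at hj'
  obtain ⟨a', b, h4, h5, h6⟩ := exists_constant_of_mem_Xsub hs hst hw 0
  obtain ⟨y, hy, hyx⟩ := hxs
  refine not_constant_of_mem_Xsub hs hy a' b fun k hk hk' => ?_
  obtain ⟨m, rfl⟩ : ∃ m : ℕ, k = m := ⟨k.toNat, by omega⟩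
  rw [hyx m (by omega), ← hwx m (by omega), h6 m (by omega) (by omega)]

section Potential

variable {α : ℝ} {β : ℕ → ℝ}

theorem phiN_le_of_forall_ne (hα : 0 < α) {c : ℕ → ℝ} {n : ℕ} (hn : 1 ≤ n) {x : Bin} {m : ℕ}
    (h : ∀ y ∈ Xsub n, ∃ i : ℤ, i.natAbs ≤ m ∧ x i ≠ y i) :
    phiN α c n x ≤ c n - deltaSeq α m :=
  sub_le_sub_left (deltaSeq_le_deltaOf hα (pow_le_distToSet hn h) (distToSet_le_half hn x)) _

theorem phi_le_neg_deltaSeq (hα : 0 < α) (hβ : ∀ n, 1 ≤ n → α ≤ β n) {x : Bin} {i j : ℕ}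
    (hx : ¬ SegIn x 0 j Yset) (hi : i < j) :
    phi α (cseq β) (fun k => x (k + i)) ≤ -deltaSeq α j := by
  refine ciSup_le fun n => ?_
  have h := phiN_le_of_forall_ne (c := cseq β) hα (Nat.le_add_left 1 n)
    (x := fun k => x (k + i)) fun y hy => exists_ne_of_not_segIn hx hi (Nat.le_add_left 1 n) hy
  linarith [cseq_nonpos hα hβ (Nat.le_add_left 1 n)]

theorem phi_le_cseq_sub_deltaSeq (hα : 0 < α) (hβ : ∀ n, 1 ≤ n → α ≤ β n) {x : Bin} {i j s : ℕ}
    (hx : ¬ SegIn x 0 j Yset) (hi : i < j) (hs : 1 ≤ s) (hj : 2 ^ (s + 3) ≤ j)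
    (hxs : WordIn x j (Xsub s)) :
    phi α (cseq β) (fun k => x (k + i)) ≤ cseq β s - deltaSeq α j := by
  refine ciSup_le fun n => ?_
  have hn : 1 ≤ n + 1 := Nat.le_add_left 1 n
  rcases le_or_gt (n + 1) s with hns | hns
  · have h := phiN_le_of_forall_ne (c := cseq β) hα hn
      (x := fun k => x (k + i)) fun y hy => exists_ne_of_not_segIn hx hi hn hy
    linarith [cseq_mono hα hβ hn hns]
  · have h := phiN_le_of_forall_ne (c := cseq β) hα hn
      (x := fun k => x (k + i)) fun y hy => exists_ne_of_wordIn hs hj hxs hi hns hy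
    linarith [cseq_nonpos hα hβ hn, neg_cseq_le hα hβ hs, deltaSeq_add_le hα hj]

theorem phiN_nonpos (hα : 0 < α) (hβ : ∀ n, 1 ≤ n → α ≤ β n) {n : ℕ} (hn : 1 ≤ n) (x : Bin) :
    phiN α (cseq β) n x ≤ 0 := by
  have h1 := cseq_nonpos hα hβ hn
  have h2 := deltaOf_nonneg hα (distToSet_nonneg x (Xsub n)) (distToSet_le_half hn x)
  unfold phiN
  linarith

theorem phi_nonpos (hα : 0 < α) (hβ : ∀ n, 1 ≤ n → α ≤ β n) (x : Bin) :
    phi α (cseq β) x ≤ 0 :=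
  ciSup_le fun n => phiN_nonpos hα hβ (Nat.le_add_left 1 n) x

theorem le_phi (hα : 0 < α) (hβ : ∀ n, 1 ≤ n → α ≤ β n) (x : Bin) :
    cseq β 1 - 10 / α ≤ phi α (cseq β) x := by
  have hb : BddAbove (Set.range fun n : ℕ => phiN α (cseq β) (n + 1) x) :=
    ⟨0, by rintro _ ⟨n, rfl⟩; exact phiN_nonpos hα hβ (Nat.le_add_left 1 n) x⟩
  refine le_trans ?_ (le_ciSup hb 0)
  exact sub_le_sub_left (deltaOf_le hα (distToSet_nonneg x _) (distToSet_le_half le_rfl x)) _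

/-! ### Measurability -/

theorem isOpen_setOf_binDist_lt (y : Bin) (r : ℝ) : IsOpen {x : Bin | binDist x y < r} := by
  refine isOpen_of_local fun x hx => ?_
  have key : ∃ m : ℕ, (1 / 2 : ℝ) ^ m < r ∧ ∀ i : ℤ, i.natAbs < m → x i = y i := by
    by_cases hxy : x = y
    · subst hxy
      have hr : 0 < r := lt_of_le_of_lt (binDist_nonneg x x) hx
      obtain ⟨m, hm⟩ := exists_pow_lt_of_lt_one hr (by norm_num : (1 / 2 : ℝ) < 1)
      exact ⟨m, hm, fun _ _ => rfl⟩
    · refine ⟨_, by simpa [binDist, hxy] using hx, fun i hi => ?_⟩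
      by_contra hne
      exact Nat.notMem_of_lt_sInf hi ⟨i, rfl, hne⟩
  obtain ⟨m, hm, hxy⟩ := key
  refine ⟨Finset.Icc (-m) m, fun z hz => (binDist_le_pow fun i hi => ?_).trans_lt hm⟩
  rw [hz i (Finset.mem_Icc.2 ⟨by omega, by omega⟩), hxy i hi]

theorem measurable_distToSet {S : Set Bin} (hS : S.Nonempty) :
    Measurable fun x => distToSet x S := by
  refine measurable_of_Iio fun r => IsOpen.measurableSet ?_
  have : (fun x => distToSet x S) ⁻¹' Set.Iio r = ⋃ y ∈ S, {x | binDist x y < r} := by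
    ext x
    simp [distToSet, csInf_lt_iff (bddBelow_binDist x S) (hS.image _)]
  rw [this]
  exact isOpen_biUnion fun y _ => isOpen_setOf_binDist_lt y r

theorem measurable_deltaOf : Measurable (deltaOf α) := by
  unfold deltaOf
  refine Measurable.ite (measurableSet_singleton 0) measurable_const ?_
  unfold Real.logb
  fun_prop

theorem measurable_phi (c : ℕ → ℝ) : Measurable (phi α c) :=
  Measurable.iSup fun n => measurable_const.sub
    (measurable_deltaOf.comp (measurable_distToSet (Xsub_nonempty (Nat.le_add_left 1 n))))

theorem integrable_phi (hα : 0 < α) (hβ : ∀ n, 1 ≤ n → α ≤ β n) (μ : Measure (Bin × Bin))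
    [IsProbabilityMeasure μ] : Integrable (fun p => phi α (cseq β) p.1) μ :=
  Integrable.of_mem_Icc (cseq β 1 - 10 / α) 0
    ((measurable_phi _).comp measurable_fst).aemeasurable
    (ae_of_all _ fun p => ⟨le_phi hα hβ p.1, phi_nonpos hα hβ p.1⟩)

end Potential

theorem measurableSet_segIn (i j : ℤ) (Y : Set Bin) : MeasurableSet {x | SegIn x i j Y} := by
  refine (isOpen_of_local ?_).measurableSet
  rintro x ⟨y, hy, h⟩
  refine ⟨Finset.Icc i j, fun z hz => ⟨y, hy, fun m h1 h2 => ?_⟩⟩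
  rw [h m h1 h2, hz m (Finset.mem_Icc.2 ⟨h1, h2⟩)]

theorem measurableSet_wordIn (j : ℕ) (Y : Set Bin) : MeasurableSet {x | WordIn x j Y} := by
  refine (isOpen_of_local ?_).measurableSet
  rintro x ⟨y, hy, h⟩
  refine ⟨Finset.Icc 0 j, fun z hz => ⟨y, hy, fun m hm => ?_⟩⟩
  rw [h m hm, hz m (Finset.mem_Icc.2 ⟨by omega, by omega⟩)]

theorem measurableSet_snd_apply_eq (k : ℤ) (b : Bool) :
    MeasurableSet {p : Bin × Bin | p.2 k = b} :=
  measurableSet_eq_fun ((measurable_pi_apply k).comp measurable_snd) measurable_const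

theorem measurableSet_PinSpace : MeasurableSet PinSpace := by
  have hseg : ∀ i j : ℤ, Measurable fun p : Bin × Bin => SegIn p.1 i j Yset := fun i j =>
    measurableSet_setOfPred.1 (measurable_fst (measurableSet_segIn i j Yset))
  have hz : ∀ k b, Measurable fun p : Bin × Bin => p.2 k = b := fun k b =>
    measurableSet_setOfPred.1 (measurableSet_snd_apply_eq k b)
  refine MeasurableSet.inter ?_ ?_ <;> refine measurableSet_setOfPred.2 ?_
  · exact .forall fun i => .forall fun j => measurable_const.imp <| .imp
      (.forall fun k => measurable_const.imp <| measurable_const.imp <| hz k _) (hseg i j)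
  · exact .forall fun i => .forall fun j => measurable_const.imp <| (hz i _).imp <| (hz j _).imp
      (hseg i j).not

theorem measurableSet_Aset : MeasurableSet Aset :=
  measurableSet_PinSpace.inter (measurableSet_snd_apply_eq 0 true)

theorem measurable_translate (a : ℤ) : Measurable (translate a) := by
  unfold translate
  fun_prop

/-! ### Return times -/

theorem translate_translate (a b : ℤ) (p : Bin × Bin) :
    translate a (translate b p) = translate (a + b) p := by
  simp [translate, add_assoc]

theorem translate_zero (p : Bin × Bin) : translate 0 p = p := by
  simp [translate]

theorem shift2_iterate (k : ℕ) : shift2^[k] = translate k := by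
  induction k with
  | zero => ext1 p; simp [translate_zero]
  | succ k ih =>
    have : shift2 = translate 1 := rfl
    ext1 p
    rw [Function.iterate_succ_apply', ih, this, translate_translate, add_comm]
    simp

theorem mem_Qset_iff {j : ℕ} (hj : 1 ≤ j) {p : Bin × Bin} :
    p ∈ Qset j ↔ p ∈ Aset ∧ translate j p ∈ Aset ∧
      ∀ k : ℕ, 1 ≤ k → k < j → translate k p ∉ Aset := by
  refine and_congr_right fun hp => ?_
  unfold retTime
  simp only [shift2_iterate]
  constructor
  · intro h
    have hne := Nat.nonempty_of_pos_sInf (h ▸ hj : 0 < sInf {k : ℕ | 1 ≤ k ∧ translate k p ∈ Aset})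
    refine ⟨h ▸ (Nat.sInf_mem hne).2, fun k h1 h2 hk => ?_⟩
    have hle : sInf {k : ℕ | 1 ≤ k ∧ translate k p ∈ Aset} ≤ k := Nat.sInf_le (And.intro h1 hk)
    omega
  · rintro ⟨h1, h2⟩
    have hmem : j ∈ {k : ℕ | 1 ≤ k ∧ translate k p ∈ Aset} := ⟨hj, h1⟩
    refine le_antisymm (Nat.sInf_le hmem) (le_csInf ⟨j, hmem⟩ fun k hk => ?_)
    by_contra! hlt
    exact h2 k hk.1 hlt hk.2

theorem measurableSet_Qset {j : ℕ} (hj : 1 ≤ j) : MeasurableSet (Qset j) := by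
  have : Qset j = Aset ∩ (translate j ⁻¹' Aset ∩
      ⋂ k : ℕ, ⋂ (_ : 1 ≤ k), ⋂ (_ : k < j), (translate k ⁻¹' Aset)ᶜ) := by
    ext p
    simp [mem_Qset_iff hj]
  rw [this]
  exact measurableSet_Aset.inter ((measurable_translate j measurableSet_Aset).inter
    (.iInter fun k => .iInter fun _ => .iInter fun _ =>
      (measurable_translate k measurableSet_Aset).compl))

theorem Qjs_eq {j s : ℕ} (hs : 1 ≤ s) : Qjs j s = Qset j ∩ {p | WordIn p.1 j (Xsub s)} := by
  rw [Qjs, if_neg (by omega)]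
  rfl

theorem measurableSet_Qjs {j s : ℕ} (hj : 1 ≤ j) (hs : 1 ≤ s) : MeasurableSet (Qjs j s) := by
  rw [Qjs_eq hs]
  exact (measurableSet_Qset hj).inter (measurable_fst (measurableSet_wordIn j (Xsub s)))

theorem not_segIn_of_mem_Qset {j : ℕ} (hj : 1 ≤ j) {p : Bin × Bin} (hp : p ∈ Qset j) :
    ¬ SegIn p.1 0 j Yset := by
  obtain ⟨h1, h2, -⟩ := (mem_Qset_iff hj).1 hp
  refine h1.1.2 0 j (by omega) h1.2 ?_
  simpa [translate] using h2.2

/-- The level `i` of the tower over `Q_j`. -/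
def towerLevel (j i : ℕ) : Set (Bin × Bin) := translate (-i) ⁻¹' Qset j

theorem measurableSet_towerLevel {j : ℕ} (hj : 1 ≤ j) (i : ℕ) :
    MeasurableSet (towerLevel j i) :=
  measurable_translate _ (measurableSet_Qset hj)

theorem shift2_iterate_preimage_towerLevel (j i : ℕ) :
    shift2^[i] ⁻¹' towerLevel j i = Qset j := by
  ext p
  simp [towerLevel, shift2_iterate, translate_translate, translate_zero]

theorem towerLevel_eq_of_mem {j j' i i' : ℕ} (hi : i < j) (hi' : i' < j') {p : Bin × Bin}
    (hp : p ∈ towerLevel j i) (hp' : p ∈ towerLevel j' i') : j = j' ∧ i = i' := by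
  have aux : ∀ {j j' i i' : ℕ}, i < j → i' < j' → p ∈ towerLevel j i → p ∈ towerLevel j' i' →
      ¬ i < i' := by
    intro j j' i i' hi hi' hp hp' hlt
    refine ((mem_Qset_iff (by omega)).1 hp').2.2 (i' - i) (by omega) (by omega) ?_
    rw [translate_translate]
    have : ((i' - i : ℕ) : ℤ) + -i' = -i := by omega
    rw [this]
    exact ((mem_Qset_iff (by omega)).1 hp).1
  obtain rfl : i = i' :=
    le_antisymm (not_lt.1 (aux hi' hi hp' hp)) (not_lt.1 (aux hi hi' hp hp'))
  exact ⟨hp.2.symm.trans hp'.2, rfl⟩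

theorem pairwise_disjoint_towerLevel :
    Pairwise (Function.onFun Disjoint
      fun a : Σ j : ℕ, Fin (j + 1) => towerLevel (a.1 + 1) a.2) := by
  rintro ⟨j, i⟩ ⟨j', i'⟩ hne
  refine Set.disjoint_left.2 fun p hp hp' => hne ?_
  obtain ⟨h1, h2⟩ := towerLevel_eq_of_mem i.2 i'.2 hp hp'
  obtain rfl : j = j' := by simpa using h1
  obtain rfl : i = i' := Fin.ext h2
  rfl

/-- Towers over the return-time partition: the one-sided form of Kac's formula. -/
theorem tsum_mul_le_lintegral {μ : Measure (Bin × Bin)} (hμ : MeasurePreserving shift2 μ μ)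
    {f : Bin × Bin → ENNReal} (hf : Measurable f) {a : ℕ → ENNReal}
    (ha : ∀ j i : ℕ, i < j + 1 → a j ≤ ∫⁻ p in Qset (j + 1), f (shift2^[i] p) ∂μ) :
    ∑' j : ℕ, (j + 1 : ENNReal) * a j ≤ ∫⁻ p, f p ∂μ := by
  calc ∑' j : ℕ, (j + 1 : ENNReal) * a j
      ≤ ∑' j : ℕ, ∑' i : Fin (j + 1), ∫⁻ p in towerLevel (j + 1) i, f p ∂μ := by
        refine ENNReal.tsum_le_tsum fun j => ?_
        calc (j + 1 : ENNReal) * a j = ∑ _i : Fin (j + 1), a j := by simp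
          _ ≤ ∑ i : Fin (j + 1), ∫⁻ p in towerLevel (j + 1) i, f p ∂μ := by
            refine Finset.sum_le_sum fun i _ => (ha j i i.2).trans_eq ?_
            rw [← (hμ.iterate i).setLIntegral_comp_preimage
              (measurableSet_towerLevel (by omega) _) hf, shift2_iterate_preimage_towerLevel]
          _ = _ := (tsum_fintype _).symm
    _ = ∫⁻ p in ⋃ a : Σ j : ℕ, Fin (j + 1), towerLevel (a.1 + 1) a.2, f p ∂μ := by
        rw [lintegral_iUnion (fun a => measurableSet_towerLevel (by omega) _)
          pairwise_disjoint_towerLevel, ENNReal.tsum_sigma']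
    _ ≤ ∫⁻ p, f p ∂μ := setLIntegral_le_lintegral _ _

section Bound

variable {α : ℝ} {β : ℕ → ℝ}

theorem two_pow_le_of_mem_Icc {j s : ℕ} (hj : 1 ≤ j)
    (hs : s ∈ Finset.Icc 1 (Nat.log 2 j - 3)) : 2 ^ (s + 3) ≤ j := by
  rw [Finset.mem_Icc] at hs
  exact (Nat.pow_le_pow_right (by norm_num) (by omega)).trans (Nat.pow_log_le_self 2 (by omega))

theorem deltaSeq_add_sum_indicator_le (hα : 0 < α) (hβ : ∀ n, 1 ≤ n → α ≤ β n) {j i : ℕ}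
    (hi : i < j) {p : Bin × Bin} (hp : p ∈ Qset j) :
    ENNReal.ofReal (deltaSeq α j) + ∑ s ∈ Finset.Icc 1 (Nat.log 2 j - 3),
        (Qjs j s).indicator (fun _ => ENNReal.ofReal (-cseq β s)) p
      ≤ ENNReal.ofReal (-phi α (cseq β) (shift2^[i] p).1) := by
  have hj : 1 ≤ j := by omega
  have hseg := not_segIn_of_mem_Qset hj hp
  rw [shift2_iterate]
  by_cases h : ∃ s ∈ Finset.Icc 1 (Nat.log 2 j - 3), p ∈ Qjs j s
  · obtain ⟨s, hs, hps⟩ := h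
    have hs1 := (Finset.mem_Icc.1 hs).1
    rw [Finset.sum_eq_single_of_mem s hs, Set.indicator_of_mem hps,
      ← ENNReal.ofReal_add (deltaSeq_nonneg hα j) (neg_nonneg.2 (cseq_nonpos hα hβ hs1))]
    · rw [Qjs_eq hs1] at hps
      refine ENNReal.ofReal_le_ofReal ?_
      have := phi_le_cseq_sub_deltaSeq hα hβ hseg hi hs1 (two_pow_le_of_mem_Icc hj hs) hps.2
      unfold translate
      linarith
    · intro t ht hts
      have ht1 := (Finset.mem_Icc.1 ht).1
      refine Set.indicator_of_notMem (fun hpt => ?_) _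
      rw [Qjs_eq hs1] at hps
      rw [Qjs_eq ht1] at hpt
      rcases lt_or_gt_of_ne hts with hlt | hlt
      · exact not_wordIn_of_lt ht1 hlt (two_pow_le_of_mem_Icc hj hs) hpt.2 hps.2
      · exact not_wordIn_of_lt hs1 hlt (two_pow_le_of_mem_Icc hj ht) hps.2 hpt.2
  · push Not at h
    rw [Finset.sum_eq_zero fun s hs => Set.indicator_of_notMem (h s hs) _, add_zero]
    refine ENNReal.ofReal_le_ofReal ?_
    have := phi_le_neg_deltaSeq hα hβ hseg hi
    unfold translate
    linarith

theorem measure_mul_add_sum_le (hα : 0 < α) (hβ : ∀ n, 1 ≤ n → α ≤ β n)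
    (μ : Measure (Bin × Bin)) {j i : ℕ} (hi : i < j) :
    ENNReal.ofReal (deltaSeq α j) * μ (Qset j) + ∑ s ∈ Finset.Icc 1 (Nat.log 2 j - 3),
        ENNReal.ofReal (-cseq β s) * μ (Qjs j s)
      ≤ ∫⁻ p in Qset j, ENNReal.ofReal (-phi α (cseq β) (shift2^[i] p).1) ∂μ := by
  have hj : 1 ≤ j := by omega
  refine le_trans (le_of_eq ?_) (setLIntegral_mono' (measurableSet_Qset hj)
    fun p hp => deltaSeq_add_sum_indicator_le hα hβ hi hp)
  have hm : ∀ s ∈ Finset.Icc 1 (Nat.log 2 j - 3), MeasurableSet (Qjs j s) := fun s hs =>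
    measurableSet_Qjs hj (Finset.mem_Icc.1 hs).1
  rw [lintegral_add_left measurable_const, setLIntegral_const, lintegral_finsetSum _
    fun s hs => measurable_const.indicator (hm s hs)]
  congr 1
  refine Finset.sum_congr rfl fun s hs => ?_
  rw [lintegral_indicator_const (hm s hs), Measure.restrict_apply (hm s hs),
    Set.inter_eq_left.2]
  rw [Qjs_eq (Finset.mem_Icc.1 hs).1]
  exact Set.inter_subset_left

theorem mul_toReal_normalized_restrict {X : Type*} [MeasurableSpace X] {μ : Measure X}
    [IsFiniteMeasure μ] {A B : Set X} (hA : μ A ≠ 0) (hB : MeasurableSet B) (hBA : B ⊆ A) :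
    μ A * ENNReal.ofReal (((μ A)⁻¹ • μ.restrict A) B).toReal = μ B := by
  have h : ((μ A)⁻¹ • μ.restrict A) B = (μ A)⁻¹ * μ B := by
    rw [Measure.smul_apply, smul_eq_mul, Measure.restrict_apply hB, Set.inter_eq_left.2 hBA]
  rw [h, ENNReal.ofReal_toReal (ENNReal.mul_ne_top (ENNReal.inv_ne_top.2 hA)
    (measure_ne_top μ B)), ← mul_assoc, ENNReal.mul_inv_cancel hA (measure_ne_top μ A), one_mul]

end Bound

theorem ofReal_integral_neg_eq {α : ℝ} {β : ℕ → ℝ} (hα : 0 < α) (hβ : ∀ n, 1 ≤ n → α ≤ β n)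
    (μ : Measure (Bin × Bin)) [IsProbabilityMeasure μ] :
    ENNReal.ofReal (-∫ p, phi α (cseq β) p.1 ∂μ) =
      ∫⁻ p, ENNReal.ofReal (-phi α (cseq β) p.1) ∂μ := by
  rw [← integral_neg]
  exact ofReal_integral_eq_lintegral_ofReal (integrable_phi hα hβ μ).neg
    (ae_of_all _ fun p => neg_nonneg.2 (phi_nonpos hα hβ p.1))

/-- the integral estimate on the pin space. -/
theorem integral_bound (α : ℝ) (β : ℕ → ℝ) (hα : 0 < α) (hαβ : α < β 1)
    (hpos : ∀ n : ℕ, 1 ≤ n → 0 < β n)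
    (hmono : ∀ m n : ℕ, 1 ≤ m → m < n → β m < β n)
    (μ : Measure (Bin × Bin)) (hprob : IsProbabilityMeasure μ)
    (herg : Ergodic shift2 μ) (hP : μ PinSpace = 1) (hA : μ Aset ≠ 0) :
    μ Aset *
      ∑' j : ℕ, ENNReal.ofReal ((j + 1 : ℝ) *
        ((((μ Aset)⁻¹ • μ.restrict Aset) (Qset (j + 1))).toReal * deltaSeq α (j + 1) +
          ∑ s ∈ Finset.Icc 1 (Nat.log 2 (j + 1) - 3),
            (-(cseq β s)) * (((μ Aset)⁻¹ • μ.restrict Aset) (Qjs (j + 1) s)).toReal))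
      ≤ ENNReal.ofReal (-∫ p, phi α (cseq β) p.1 ∂μ) := by
  have hβ : ∀ n, 1 ≤ n → α ≤ β n := fun n hn => by
    rcases hn.eq_or_lt with rfl | h
    · exact hαβ.le
    · exact (hαβ.trans (hmono 1 n le_rfl h)).le
  rw [ofReal_integral_neg_eq hα hβ, ← ENNReal.tsum_mul_left]
  refine le_trans (le_of_eq (tsum_congr fun j => ?_)) (tsum_mul_le_lintegral
    herg.toMeasurePreserving
    (((measurable_phi (α := α) (cseq β)).comp measurable_fst).neg.ennreal_ofReal)
    fun j i hi => measure_mul_add_sum_le hα hβ μ hi)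
  have hj : 1 ≤ j + 1 := Nat.le_add_left 1 j
  have hc : ∀ s ∈ Finset.Icc 1 (Nat.log 2 (j + 1) - 3), 0 ≤ -cseq β s := fun s hs =>
    neg_nonneg.2 (cseq_nonpos hα hβ (Finset.mem_Icc.1 hs).1)
  have hδ := deltaSeq_nonneg hα (j + 1)
  rw [ENNReal.ofReal_mul (by positivity), ENNReal.ofReal_add (by positivity)
    (Finset.sum_nonneg fun s hs => mul_nonneg (hc s hs) ENNReal.toReal_nonneg),
    ENNReal.ofReal_sum_of_nonneg fun s hs => mul_nonneg (hc s hs) ENNReal.toReal_nonneg,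
    ENNReal.ofReal_mul ENNReal.toReal_nonneg, mul_left_comm, mul_add, Finset.mul_sum]
  congr 1
  · rw [ENNReal.ofReal_add (by positivity) zero_le_one]
    simp
  congr 1
  · rw [← mul_assoc, mul_toReal_normalized_restrict hA (measurableSet_Qset hj) fun p hp => hp.1,
      mul_comm]
  · refine Finset.sum_congr rfl fun s hs => ?_
    have hs1 := (Finset.mem_Icc.1 hs).1
    rw [ENNReal.ofReal_mul (hc s hs), mul_left_comm,
      mul_toReal_normalized_restrict hA (measurableSet_Qjs hj hs1)]
    rw [Qjs_eq hs1]
    exact fun p hp => hp.1.1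

end PhaseTransitions
end
end

section
/- Let μ be an ergodic shift-invariant probability measure on the full two-shift X with μ(Y)=0, where Y is the closure of ⋃_n X_n. Let ν̄ be an invariant measure on the pin-sequence space P obtained as a limit point of the empirical measures along the orbit of (x′,z′), where x′ is generic for μ and z′ is a pin sequence for x′, so that ν̄∘π_X^{-1}=μ. Then the projection π_X:P→X is finite-to-one ν̄-almost everywhere, and consequently h_μ(T)=h_{ν̄}(T̄). -/
open MeasureTheory Real Filter Topology

noncomputable section

namespace PhaseTransitions

/-! ### Entropy of finite observables -/

section FiniteEntropy

variable {X Y F G : Type*} [MeasurableSpace X] [MeasurableSpace Y] [Fintype F] [Fintype G]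

lemma entOfObs_eq_sum_negMulLog (μ : Measure X) (f : X → F) :
    entOfObs μ f = (∑ a, Real.negMulLog (μ.real (f ⁻¹' {a}))) / Real.log 2 := by
  rw [Finset.sum_div]
  refine Finset.sum_congr rfl fun a _ => ?_
  rw [Real.negMulLog, Measure.real, Real.logb]
  ring

lemma entOfObs_nonneg (μ : Measure X) [IsProbabilityMeasure μ] (f : X → F) :
    0 ≤ entOfObs μ f := by
  rw [entOfObs_eq_sum_negMulLog]
  exact div_nonneg (Finset.sum_nonneg fun a _ =>
    Real.negMulLog_nonneg measureReal_nonneg measureReal_le_one) (Real.log_nonneg one_le_two)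

/-- The `n`-name of a point with respect to the observable `f`. -/
def orbitName {Z A : Type*} (T : Z → Z) (f : Z → A) (n : ℕ) (x : Z) : Fin n → A :=
  fun i => f (T^[(i : ℕ)] x)

lemma entObsT_le_div (T : X → X) (μ : Measure X) [IsProbabilityMeasure μ] (f : X → F) {n : ℕ}
    (hn : 0 < n) : entObsT T μ f ≤ entOfObs μ (orbitName T f n) / n := by
  obtain ⟨m, rfl⟩ : ∃ m, n = m + 1 := ⟨n - 1, by omega⟩
  have := ciInf_le (f := fun n : ℕ => entOfObs μ (orbitName T f (n + 1)) / ((n : ℝ) + 1))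
    ⟨0, by
      rintro _ ⟨n, rfl⟩
      exact div_nonneg (entOfObs_nonneg _ _) (by positivity)⟩ m
  push_cast
  exact this

lemma entObsT_nonneg (T : X → X) (μ : Measure X) [IsProbabilityMeasure μ] (f : X → F) :
    0 ≤ entObsT T μ f :=
  le_ciInf fun _ => div_nonneg (entOfObs_nonneg _ _) (by positivity)

variable [MeasurableSpace F] [MeasurableSingletonClass F]
  [MeasurableSpace G] [MeasurableSingletonClass G]

lemma sum_measureReal_fiber {A : Type*} [MeasurableSpace A] [MeasurableSingletonClass A]
    (μ : Measure X) [IsProbabilityMeasure μ] {f : X → A} (hf : Measurable f) (s : Finset A) :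
    ∑ a ∈ s, μ.real (f ⁻¹' {a}) = μ.real (f ⁻¹' s) :=
  sum_measureReal_preimage_singleton s fun a _ => hf (measurableSet_singleton a)

lemma sum_univ_measureReal_fiber (μ : Measure X) [IsProbabilityMeasure μ] {f : X → F}
    (hf : Measurable f) : ∑ a, μ.real (f ⁻¹' {a}) = 1 := by
  rw [sum_measureReal_fiber μ hf]; simp

lemma negMulLog_sum_le {ι : Type*} (s : Finset ι) (p : ι → ℝ) (hp : ∀ i ∈ s, 0 ≤ p i) :
    Real.negMulLog (∑ i ∈ s, p i) ≤ ∑ i ∈ s, Real.negMulLog (p i) := by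
  rw [Real.negMulLog, neg_mul, Finset.sum_mul, ← Finset.sum_neg_distrib]
  refine Finset.sum_le_sum fun i hi => ?_
  rw [Real.negMulLog, neg_mul, neg_le_neg_iff]
  rcases (hp i hi).eq_or_lt with h | h
  · simp [← h]
  · exact mul_le_mul_of_nonneg_left
      (Real.log_le_log h (Finset.single_le_sum hp hi)) h.le

/-- An observable that is almost everywhere a function of another one has smaller entropy. -/
lemma entOfObs_le_of_ae_eq_comp {B : Type*} [Fintype B] (μ : Measure X) [IsProbabilityMeasure μ]
    {f : X → F} {g : X → B} (hf : Measurable f) (φ : F → B) (h : ∀ᵐ x ∂μ, g x = φ (f x)) :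
    entOfObs μ g ≤ entOfObs μ f := by
  classical
  rw [entOfObs_eq_sum_negMulLog, entOfObs_eq_sum_negMulLog]
  refine div_le_div_of_nonneg_right ?_ (Real.log_nonneg one_le_two)
  rw [← Finset.sum_fiberwise Finset.univ φ fun a => Real.negMulLog (μ.real (f ⁻¹' {a}))]
  refine Finset.sum_le_sum fun b _ => ?_
  have hb : μ.real (g ⁻¹' {b}) = ∑ a with φ a = b, μ.real (f ⁻¹' {a}) := by
    rw [sum_measureReal_fiber μ hf]
    refine measureReal_congr ?_
    filter_upwards [h] with x hx
    refine propext (Iff.trans (b := φ (f x) = b) ?_ ?_)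
    · change g x = b ↔ _
      rw [hx]
    · change _ ↔ f x ∈ _
      simp
  rw [hb]
  exact negMulLog_sum_le _ _ fun _ _ => measureReal_nonneg

/-- An observable that, on a conull set, only depends on the value of another one has smaller
entropy. -/
lemma entOfObs_le_of_factors {B : Type*} [Fintype B] (μ : Measure X) [IsProbabilityMeasure μ]
    {f : X → F} {g : X → B} (hf : Measurable f) (S : Set X) (hS : ∀ᵐ x ∂μ, x ∈ S)
    (h : ∀ x ∈ S, ∀ y ∈ S, f x = f y → g x = g y) :
    entOfObs μ g ≤ entOfObs μ f := by
  classical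
  obtain ⟨x₀, -⟩ := hS.exists
  refine entOfObs_le_of_ae_eq_comp μ hf
    (fun a => if ha : ∃ x ∈ S, f x = a then g ha.choose else g x₀) ?_
  filter_upwards [hS] with x hx
  have hex : ∃ y ∈ S, f y = f x := ⟨x, hx, rfl⟩
  rw [dif_pos hex]
  exact h x hx _ hex.choose_spec.1 hex.choose_spec.2.symm

/-- Subadditivity of entropy under joining observables. -/
lemma entOfObs_prod_le (μ : Measure X) [IsProbabilityMeasure μ] {f : X → F} {g : X → G}
    (hf : Measurable f) (hg : Measurable g) :
    entOfObs μ (fun x => (f x, g x)) ≤ entOfObs μ f + entOfObs μ g := by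
  classical
  have hfg : Measurable fun x => (f x, g x) := hf.prodMk hg
  set P : F → G → ℝ := fun a b => μ.real ((fun x => (f x, g x)) ⁻¹' {(a, b)})
  set p : F → ℝ := fun a => μ.real (f ⁻¹' {a}) with hp
  set q : G → ℝ := fun b => μ.real (g ⁻¹' {b}) with hq
  have hPp : ∀ a b, P a b ≤ p a := fun a b => measureReal_mono fun x hx =>
    congrArg Prod.fst (show (f x, g x) = (a, b) from hx)
  have hPq : ∀ a b, P a b ≤ q b := fun a b => measureReal_mono fun x hx =>
    congrArg Prod.snd (show (f x, g x) = (a, b) from hx)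
  have hsum (s : Finset (F × G)) : ∑ c ∈ s, P c.1 c.2 = μ.real ((fun x => (f x, g x)) ⁻¹' s) :=
    sum_measureReal_fiber μ hfg s
  have hrow : ∀ a, ∑ b, P a b = p a := fun a => by
    have := hsum ({a} ×ˢ Finset.univ)
    rw [Finset.sum_product] at this
    simp only [Finset.sum_singleton] at this
    rw [this, hp]
    congr 1
    ext x; simp [eq_comm]
  have hcol : ∀ b, ∑ a, P a b = q b := fun b => by
    have := hsum (Finset.univ ×ˢ {b})
    rw [Finset.sum_product] at this
    simp only [Finset.sum_singleton] at this
    rw [this, hq]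
    congr 1
    ext x; simp [eq_comm]
  have hone_p : ∑ a, p a = 1 := sum_univ_measureReal_fiber μ hf
  have hone_q : ∑ b, q b = 1 := sum_univ_measureReal_fiber μ hg
  have key : ∀ a b, Real.negMulLog (P a b) ≤
      -(P a b * Real.log (p a)) - P a b * Real.log (q b) + (p a * q b - P a b) := by
    intro a b
    have h0 : 0 ≤ P a b := measureReal_nonneg
    rcases h0.eq_or_lt with h | h
    · rw [← h]
      have : 0 ≤ p a * q b := mul_nonneg measureReal_nonneg measureReal_nonneg
      simpa using this
    · have hpa := h.trans_le (hPp a b)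
      have hqb := h.trans_le (hPq a b)
      have hlog := Real.log_le_sub_one_of_pos (x := p a * q b / P a b) (by positivity)
      rw [Real.log_div (by positivity) h.ne', Real.log_mul hpa.ne' hqb.ne'] at hlog
      have := mul_le_mul_of_nonneg_left hlog h.le
      rw [mul_sub (P a b) (_ / _), mul_div_cancel₀ _ h.ne'] at this
      rw [Real.negMulLog]
      linarith
  rw [entOfObs_eq_sum_negMulLog, entOfObs_eq_sum_negMulLog, entOfObs_eq_sum_negMulLog, ← add_div]
  refine div_le_div_of_nonneg_right ?_ (Real.log_nonneg one_le_two)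
  rw [Fintype.sum_prod_type]
  refine (Finset.sum_le_sum fun a _ => Finset.sum_le_sum fun b _ => key a b).trans ?_
  simp only [Finset.sum_add_distrib, Finset.sum_sub_distrib, Finset.sum_neg_distrib,
    ← Finset.sum_mul, ← Finset.mul_sum, hrow, hone_q, hone_p, mul_one]
  rw [Finset.sum_comm]
  simp only [← Finset.sum_mul, hcol]
  simp only [Real.negMulLog, neg_mul, Finset.sum_neg_distrib, hp, hq]
  linarith

lemma entOfObs_le_logb_card (μ : Measure X) [IsProbabilityMeasure μ] {f : X → F}
    (hf : Measurable f) : entOfObs μ f ≤ Real.logb 2 (Fintype.card F) := by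
  have hone := sum_univ_measureReal_fiber μ hf
  have hne : Nonempty F := by
    by_contra h
    rw [not_nonempty_iff] at h
    simp at hone
  have hc : (0 : ℝ) < Fintype.card F := by exact_mod_cast Fintype.card_pos
  rw [entOfObs_eq_sum_negMulLog, Real.logb]
  refine div_le_div_of_nonneg_right ?_ (Real.log_nonneg one_le_two)
  have key : ∀ a, Real.negMulLog (μ.real (f ⁻¹' {a})) ≤
      μ.real (f ⁻¹' {a}) * Real.log (Fintype.card F) +
        ((Fintype.card F : ℝ)⁻¹ - μ.real (f ⁻¹' {a})) := by
    intro a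
    have h0 : 0 ≤ μ.real (f ⁻¹' {a}) := measureReal_nonneg
    generalize μ.real (f ⁻¹' {a}) = p at h0
    rcases h0.eq_or_lt with h | h
    · rw [← h]; simp
    · have hlog := Real.log_le_sub_one_of_pos (x := (Fintype.card F : ℝ)⁻¹ / p) (by positivity)
      rw [Real.log_div (by positivity) h.ne', Real.log_inv] at hlog
      have := mul_le_mul_of_nonneg_left hlog h.le
      rw [mul_sub p (_ / _), mul_div_cancel₀ _ h.ne'] at this
      rw [Real.negMulLog]
      linarith
  refine (Finset.sum_le_sum fun a _ => key a).trans ?_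
  rw [Finset.sum_add_distrib, Finset.sum_sub_distrib, ← Finset.sum_mul, hone]
  simp [hc.ne']

lemma entOfObs_comp_of_measurePreserving {μ : Measure X} {ν : Measure Y} {φ : X → Y}
    (hφ : MeasurePreserving φ μ ν) {f : Y → F} (hf : Measurable f) :
    entOfObs μ (fun x => f (φ x)) = entOfObs ν f := by
  refine Finset.sum_congr rfl fun a _ => ?_
  rw [← hφ.measure_preimage (hf (measurableSet_singleton a)).nullMeasurableSet]
  rfl

lemma measurable_orbitName {A : Type*} [MeasurableSpace A] {T : X → X} (hT : Measurable T)
    {f : X → A} (hf : Measurable f) (n : ℕ) : Measurable (orbitName T f n) :=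
  measurable_pi_lambda _ fun i => hf.comp (hT.iterate i)

lemma entOfObs_orbitName_add_le {μ : Measure X} [IsProbabilityMeasure μ] {T : X → X}
    (hT : MeasurePreserving T μ μ) {f : X → F} (hf : Measurable f) (m n : ℕ) :
    entOfObs μ (orbitName T f (m + n)) ≤
      entOfObs μ (orbitName T f m) + entOfObs μ (orbitName T f n) := by
  have hm := measurable_orbitName hT.measurable hf m
  have hn := measurable_orbitName hT.measurable hf n
  have hTm := hT.iterate m
  have hn' : Measurable fun x => orbitName T f n (T^[m] x) := hn.comp hTm.measurable
  rw [← entOfObs_comp_of_measurePreserving hTm hn]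
  refine le_trans ?_ (entOfObs_prod_le μ hm hn')
  refine entOfObs_le_of_factors μ (hm.prodMk hn') Set.univ (by simp) fun x _ y _ hxy => ?_
  rw [Prod.mk.injEq] at hxy
  funext i
  refine Fin.addCases (fun j => congrFun hxy.1 j) (fun j => ?_) i
  have := congrFun hxy.2 j
  simpa only [orbitName, ← Function.iterate_add_apply, Fin.val_natAdd, add_comm m] using this

lemma entOfObs_orbitName_mul_le {μ : Measure X} [IsProbabilityMeasure μ] {T : X → X}
    (hT : MeasurePreserving T μ μ) {f : X → F} (hf : Measurable f) (m n : ℕ) :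
    entOfObs μ (orbitName T f ((m + 1) * n)) ≤ (m + 1) * entOfObs μ (orbitName T f n) := by
  induction m with
  | zero =>
    have h : (0 + 1) * n = n := by omega
    rw [h]
    simp
  | succ m ih =>
    rw [add_mul (m + 1) 1 n, one_mul]
    refine (entOfObs_orbitName_add_le hT hf _ _).trans ?_
    push_cast
    linarith

lemma entObsT_le_logb_card {T : X → X} (hT : Measurable T) (μ : Measure X)
    [IsProbabilityMeasure μ] {f : X → F} (hf : Measurable f) :
    entObsT T μ f ≤ Real.logb 2 (Fintype.card F) := by
  have h1 := entObsT_le_div T μ f one_pos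
  have h2 := entOfObs_le_logb_card μ (measurable_orbitName hT hf 1)
  simp only [Fintype.card_pi, Finset.prod_const, Finset.card_univ, Fintype.card_fin, pow_one,
    Nat.cast_one, div_one] at h1 h2
  exact h1.trans h2

/-- If the entropy of the `n`-names of `g` exceeds that of the `n`-names of `f` by at most a
constant, then the entropy rate of `g` is at most that of `f`. -/
lemma entObsT_le_of_orbitName_le {μ : Measure X} [IsProbabilityMeasure μ] {T : X → X}
    (hT : MeasurePreserving T μ μ) {f : X → F} (hf : Measurable f)
    {B : Type*} [Fintype B] {ν : Measure Y} [IsProbabilityMeasure ν] {S : Y → Y} {g : Y → B} (C : ℝ)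
    (h : ∀ n, entOfObs ν (orbitName S g n) ≤ entOfObs μ (orbitName T f n) + C) :
    entObsT S ν g ≤ entObsT T μ f := by
  refine le_ciInf fun n => ?_
  change _ ≤ entOfObs μ (orbitName T f (n + 1)) / _
  set a := entOfObs μ (orbitName T f (n + 1))
  have key : ∀ m : ℕ, entObsT S ν g ≤ a / (n + 1) + C / (n + 1) * (1 / ((m : ℝ) + 1)) := by
    intro m
    refine (entObsT_le_div S ν g (n := (m + 1) * (n + 1)) (by positivity)).trans ?_
    have := (h ((m + 1) * (n + 1))).trans
      (add_le_add_left (entOfObs_orbitName_mul_le hT hf m (n + 1)) C)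
    refine (div_le_div_of_nonneg_right this (by positivity)).trans (le_of_eq ?_)
    push_cast
    field_simp
    rfl
  have hlim := (tendsto_one_div_add_atTop_nhds_zero_nat (𝕜 := ℝ)).const_mul (C / (n + 1))
  have hlim' := hlim.const_add (a / (n + 1))
  rw [mul_zero, add_zero] at hlim'
  exact ge_of_tendsto' hlim' key

lemma entObsT_comp_injective {μ : Measure X} [IsProbabilityMeasure μ] {T : X → X}
    (hT : MeasurePreserving T μ μ) {A : Type*} [Fintype A] [MeasurableSpace A] {f : X → A}
    (hf : Measurable f) {e : A → G} (he : Function.Injective e) (hem : Measurable e) :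
    entObsT T μ f ≤ entObsT T μ (fun x => e (f x)) := by
  refine entObsT_le_of_orbitName_le hT (hem.comp hf) 0 fun n => ?_
  rw [add_zero]
  refine entOfObs_le_of_factors μ (measurable_orbitName hT.measurable (hem.comp hf) n)
    Set.univ (by simp) fun x _ y _ hxy => ?_
  funext i
  exact he (congrFun hxy i)

lemma entObsT_comp_of_measurePreserving {μ : Measure X} {ν : Measure Y} {φ : X → Y}
    (hφ : MeasurePreserving φ μ ν) {S : X → X} {T : Y → Y} (hT : Measurable T)
    (hST : ∀ x, φ (S x) = T (φ x)) {f : Y → F} (hf : Measurable f) :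
    entObsT S μ (fun x => f (φ x)) = entObsT T ν f := by
  refine iInf_congr fun n => ?_
  have : (fun x => fun i : Fin (n + 1) => f (φ (S^[(i : ℕ)] x))) =
      fun x => orbitName T f (n + 1) (φ x) := by
    funext x i
    have : Function.Semiconj φ S T := hST
    rw [orbitName, (this.iterate_right i).eq]
  rw [this, entOfObs_comp_of_measurePreserving hφ (measurable_orbitName hT hf _)]
  rfl

/-- A factor map has the same entropy as soon as every finite observable upstairs is dominated,
in entropy rate, by an observable downstairs with a controlled number of values. -/
lemma kolSinai_eq_of_factor {μ : Measure X} {ν : Measure Y} [IsProbabilityMeasure μ]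
    [IsProbabilityMeasure ν] {φ : X → Y} (hφ : MeasurePreserving φ μ ν) {S : X → X} {T : Y → Y}
    (hS : Measurable S) (hT : Measurable T) (hST : ∀ x, φ (S x) = T (φ x))
    (hdom : ∀ k : ℕ, ∃ l : ℕ, ∀ g : X → Fin k, Measurable g →
      ∃ f : Y → Fin l, Measurable f ∧ entObsT S μ g ≤ entObsT T ν f) :
    kolSinai T ν = kolSinai S μ := by
  unfold kolSinai
  set a : ℕ → ℝ := fun k => ⨆ f : {f : Y → Fin k // Measurable f}, entObsT T ν f.1
  set b : ℕ → ℝ := fun k => ⨆ g : {g : X → Fin k // Measurable g}, entObsT S μ g.1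
  have bdd_a : ∀ k, BddAbove (Set.range fun f : {f : Y → Fin k // Measurable f} =>
      entObsT T ν f.1) := fun k => ⟨_, by
    rintro _ ⟨f, rfl⟩
    exact entObsT_le_logb_card hT ν f.2⟩
  have bdd_b : ∀ k, BddAbove (Set.range fun g : {g : X → Fin k // Measurable g} =>
      entObsT S μ g.1) := fun k => ⟨_, by
    rintro _ ⟨f, rfl⟩
    exact entObsT_le_logb_card hS μ f.2⟩
  have ha0 : ∀ k, 0 ≤ a k := fun k => Real.iSup_nonneg fun f => entObsT_nonneg _ _ _
  have hb0 : ∀ k, 0 ≤ b k := fun k => Real.iSup_nonneg fun f => entObsT_nonneg _ _ _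
  have hab : ∀ k, a k ≤ b k := fun k => Real.iSup_le (fun f => by
    rw [← entObsT_comp_of_measurePreserving hφ hT hST f.2]
    exact le_ciSup (bdd_b k) ⟨fun x => f.1 (φ x), f.2.comp hφ.measurable⟩) (hb0 k)
  have hba : ∀ k, ∃ l, b k ≤ a l := fun k => by
    obtain ⟨l, hl⟩ := hdom k
    refine ⟨l, Real.iSup_le (fun g => ?_) (ha0 l)⟩
    obtain ⟨f, hf, hgf⟩ := hl g.1 g.2
    exact hgf.trans (le_ciSup (bdd_a l) ⟨f, hf⟩)
  by_cases hB : BddAbove (Set.range a)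
  · refine le_antisymm ?_ ?_
    · obtain ⟨c, hc⟩ := hB
      refine ciSup_mono ⟨c, ?_⟩ hab
      rintro _ ⟨k, rfl⟩
      obtain ⟨l, hl⟩ := hba k
      exact hl.trans (hc ⟨l, rfl⟩)
    · refine ciSup_le fun k => ?_
      obtain ⟨l, hl⟩ := hba k
      exact hl.trans (le_ciSup hB l)
  · rw [Real.iSup_of_not_bddAbove hB, Real.iSup_of_not_bddAbove]
    rintro ⟨c, hc⟩
    refine hB ⟨c, ?_⟩
    rintro _ ⟨k, rfl⟩
    exact (hab k).trans (hc ⟨k, rfl⟩)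

end FiniteEntropy

/-! ### Measurable selection from finite fibres -/

section Selection

variable {X Z : Type*} [MeasurableSpace X]

open Classical in
/-- A finite family of measurable sets admits a measurable index of a set containing the point. -/
lemma exists_measurable_index {K : ℕ} [NeZero K] (C : Fin K → Set X)
    (hC : ∀ i, MeasurableSet (C i)) :
    ∃ idx : X → Fin K, Measurable idx ∧ ∀ x, (∃ i, x ∈ C i) → x ∈ C (idx x) := by
  have hex : ∀ x, ∃ n : ℕ, x ∈ C (Fin.ofNat K n) ∨ ∀ i, x ∉ C i := fun x => by
    by_cases h : ∃ i, x ∈ C i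
    · obtain ⟨i, hi⟩ := h
      exact ⟨i, Or.inl (by simpa using hi)⟩
    · exact ⟨0, Or.inr (not_exists.mp h)⟩
  refine ⟨fun x => Fin.ofNat K (Nat.find (hex x)), ?_, fun x hx => ?_⟩
  · refine Measurable.find (f := fun n _ => Fin.ofNat K n)
      (p := fun n x => x ∈ C (Fin.ofNat K n) ∨ ∀ i, x ∉ C i)
      (fun _ => measurable_const) (fun n => ?_) hex
    rw [Set.ofPred_or, Set.ofPred_forall]
    exact (hC _).union (MeasurableSet.iInter fun i => (hC i).compl)
  · exact (Nat.find_spec (hex x)).resolve_right fun h => hx.elim h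

variable [MeasurableSpace Z] [MeasurableEq Z]

open Classical in
/-- A sequence of measurable maps contains, pointwise, either `K` distinct values which can be
chosen measurably, or is exhausted by `K` measurable maps. -/
lemma exists_measurable_enumeration (s : ℕ → X → Z) (hs : ∀ n, Measurable (s n)) (K : ℕ) :
    ∃ t : Fin K → X → Z, (∀ i, Measurable (t i)) ∧ ∀ x,
      (∀ n, ∃ i, t i x = s n x) ∨
        (Function.Injective (fun i => t i x) ∧ ∀ i, ∃ n, t i x = s n x) := by
  induction K with
  | zero =>
    exact ⟨Fin.elim0, fun i => i.elim0, fun x => Or.inr ⟨fun i => i.elim0, fun i => i.elim0⟩⟩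
  | succ K ih =>
    obtain ⟨t, ht, hst⟩ := ih
    have hex : ∀ x, ∃ n, (∀ i, t i x ≠ s n x) ∨ ∀ m, ∃ i, t i x = s m x := fun x => by
      by_cases h : ∀ m, ∃ i, t i x = s m x
      · exact ⟨0, Or.inr h⟩
      · push Not at h
        exact h.imp fun n hn => Or.inl hn
    have hmeas : ∀ i n, MeasurableSet {x | t i x = s n x} := fun i n =>
      measurableSet_eq_fun (ht i) (hs n)
    refine ⟨Fin.snoc (α := fun _ => X → Z) t fun x => s (Nat.find (hex x)) x,
      fun i => ?_, fun x => ?_⟩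
    · refine Fin.lastCases ?_ (fun i => ?_) i
      · rw [Fin.snoc_last]
        refine Measurable.find hs (fun n => ?_) hex
        rw [Set.ofPred_or, Set.ofPred_forall, Set.ofPred_forall]
        refine (MeasurableSet.iInter fun i => (hmeas i n).compl).union
          (MeasurableSet.iInter fun m => ?_)
        rw [Set.ofPred_exists]
        exact MeasurableSet.iUnion fun i => hmeas i m
      · rw [Fin.snoc_castSucc]
        exact ht i
    · rcases Nat.find_spec (hex x) with h | h
      · rcases hst x with h' | ⟨hinj, hrange⟩
        · obtain ⟨i, hi⟩ := h' (Nat.find (hex x))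
          exact absurd hi (h i)
        · refine Or.inr ⟨fun i j => ?_, fun i => ?_⟩
          · refine Fin.lastCases ?_ (fun i => ?_) i <;> refine Fin.lastCases ?_ (fun j => ?_) j
            · simp
            · simp only [Fin.snoc_last, Fin.snoc_castSucc]
              exact fun he => absurd he.symm (h j)
            · simp only [Fin.snoc_last, Fin.snoc_castSucc]
              exact fun he => absurd he (h i)
            · simp only [Fin.snoc_castSucc]
              exact fun he => congrArg _ (hinj he)
          · refine Fin.lastCases ?_ (fun i => ?_) i
            · exact ⟨Nat.find (hex x), by rw [Fin.snoc_last]⟩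
            · rw [Fin.snoc_castSucc]
              exact hrange i
      · refine Or.inl fun n => ?_
        obtain ⟨i, hi⟩ := h n
        exact ⟨i.castSucc, by rw [Fin.snoc_castSucc]; exact hi⟩

end Selection

/-- A compact subset of `X × {0,1}^ℤ` with fibres of bounded cardinality over `E` is covered,
over `E`, by the graphs of finitely many measurable maps. -/
lemma exists_measurable_sections {P : Set (Bin × Bin)} (hP : IsCompact P) {E : Set Bin} {L : ℕ}
    (hE : ∀ x ∈ E, ∀ S : Finset Bin, (∀ z ∈ S, (x, z) ∈ P) → S.card ≤ L) :
    ∃ (K : ℕ) (t : Fin (K + 1) → Bin → Bin), (∀ i, Measurable (t i)) ∧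
      ∀ x ∈ E, ∀ z, (x, z) ∈ P → ∃ i, t i x = z := by
  classical
  let hit : Finset ℤ × Finset ℤ → Bin → ℤ → Prop := fun c x k =>
    ∃ z, (x, z) ∈ P ∧ ((∀ a ∈ c.1, z a = true) ∧ ∀ b ∈ c.2, z b = false) ∧ z k = true
  have hhit : ∀ c k, MeasurableSet {x | hit c x k} := fun c k => by
    have hC : IsClosed {z : Bin | ((∀ a ∈ c.1, z a = true) ∧ ∀ b ∈ c.2, z b = false) ∧
        z k = true} := by
      have hco : ∀ (a : ℤ) (v : Bool), IsClosed {z : Bin | z a = v} := fun a v =>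
        isClosed_eq (continuous_apply a) continuous_const
      refine IsClosed.and (IsClosed.and ?_ ?_) (hco k true)
      · simp only [Set.ofPred_forall]
        exact isClosed_biInter fun a _ => hco a true
      · simp only [Set.ofPred_forall]
        exact isClosed_biInter fun a _ => hco a false
    have := ((hP.inter_right (hC.preimage continuous_snd)).image continuous_fst).isClosed
    convert this.measurableSet using 1
    ext x
    constructor
    · rintro ⟨z, hz, hz'⟩
      exact ⟨(x, z), ⟨hz, hz'⟩, rfl⟩
    · rintro ⟨⟨_, z⟩, ⟨hz, hz'⟩, rfl⟩
      exact ⟨z, hz, hz'⟩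
  let s : Finset ℤ × Finset ℤ → Bin → Bin := fun c x k => decide (hit c x k)
  have hs : ∀ c, Measurable (s c) := fun c => measurable_pi_lambda _ fun k =>
    measurable_to_bool (by convert hhit c k using 1; ext x; simp [s])
  obtain ⟨e, he⟩ := exists_surjective_nat (Finset ℤ × Finset ℤ)
  obtain ⟨t, ht, hts⟩ :=
    exists_measurable_enumeration (fun n => s (e n)) (fun n => hs _) (2 ^ L + 1)
  refine ⟨2 ^ L, t, ht, fun x hx z hz => ?_⟩
  have hfin : {z | (x, z) ∈ P}.Finite := by
    by_contra hinf
    obtain ⟨S, hS, hcard⟩ := Set.Infinite.exists_subset_card_eq hinf (L + 1)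
    have := hE x hx S fun z hz => hS hz
    omega
  set F := hfin.toFinset with hF
  have hmemF : ∀ z, z ∈ F ↔ (x, z) ∈ P := fun z => by simp [hF]
  have hFcard : F.card ≤ L := hE x hx F fun z hz => (hmemF z).1 hz
  have hsF : ∀ c, s c x ∈ F.powerset.image fun A k => decide (∃ z ∈ A, z k = true) := fun c => by
    refine Finset.mem_image.2 ⟨F.filter fun z =>
      (∀ a ∈ c.1, z a = true) ∧ ∀ b ∈ c.2, z b = false,
      Finset.mem_powerset.2 (Finset.filter_subset _ _), ?_⟩
    funext k
    simp only [s, hit, Finset.mem_filter, hmemF, and_assoc]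
  rcases hts x with h | ⟨hinj, hrange⟩
  · have hsep : ∀ w : Bin, ∃ a : ℤ, w ≠ z → w a ≠ z a := fun w => by
      by_cases h : w = z
      · exact ⟨0, fun h' => absurd h h'⟩
      · obtain ⟨a, ha⟩ := Function.ne_iff.1 h
        exact ⟨a, fun _ => ha⟩
    choose d hd using hsep
    let c : Finset ℤ × Finset ℤ :=
      ((F.image d).filter fun a => z a = true, (F.image d).filter fun a => z a = false)
    have huniq : ∀ w, (x, w) ∈ P → ((∀ a ∈ c.1, w a = true) ∧ ∀ b ∈ c.2, w b = false) → w = z := by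
      intro w hw hwc
      by_contra hne
      have hdw : d w ∈ F.image d := Finset.mem_image_of_mem d ((hmemF w).2 hw)
      refine hd w hne ?_
      cases hzv : z (d w) with
      | true => exact hwc.1 _ (Finset.mem_filter.2 ⟨hdw, hzv⟩)
      | false => exact hwc.2 _ (Finset.mem_filter.2 ⟨hdw, hzv⟩)
    have hsz : s c x = z := by
      funext k
      have : hit c x k ↔ z k = true := by
        constructor
        · rintro ⟨w, hw, hwc, hwk⟩
          rwa [← huniq w hw hwc]
        · exact fun hk => ⟨z, hz, ⟨fun a ha => (Finset.mem_filter.1 ha).2,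
            fun b hb => (Finset.mem_filter.1 hb).2⟩, hk⟩
      simp [s, this]
    obtain ⟨n, hn⟩ := he c
    obtain ⟨i, hi⟩ := h n
    exact ⟨i, by rw [hi, hn, hsz]⟩
  · have h1 : (Finset.univ.image fun i => t i x) ⊆
        F.powerset.image fun A k => decide (∃ z ∈ A, z k = true) := by
      intro w hw
      obtain ⟨i, -, rfl⟩ := Finset.mem_image.1 hw
      obtain ⟨n, hn⟩ := hrange i
      simp only [hn]
      exact hsF (e n)
    have h2 := (Finset.card_le_card h1).trans Finset.card_image_le
    rw [Finset.card_image_of_injective _ hinj, Finset.card_powerset, Finset.card_univ,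
      Fintype.card_fin] at h2
    have h3 := Nat.pow_le_pow_right two_pos hFcard
    omega

/-! ### Entropy of bounded-to-one extensions -/

/-- If, almost everywhere, the fibre of a skew-product-like extension is covered by the graphs of
finitely many measurable sections, then the extension has the same entropy as its base. -/
lemma kolSinai_eq_of_sections {X Z : Type*} [MeasurableSpace X] [MeasurableSpace Z] [MeasurableEq Z]
    {T : X → X} {R : Z → Z} (hR : Measurable R)
    {μ : Measure X} [IsProbabilityMeasure μ] (hT : MeasurePreserving T μ μ)
    {ν : Measure (X × Z)} [IsProbabilityMeasure ν]
    (hν : MeasurePreserving (Prod.map T R) ν ν) (hproj : MeasurePreserving Prod.fst ν μ)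
    {K : ℕ} [NeZero K] (t : Fin K → X → Z) (ht : ∀ i, Measurable (t i))
    (hcov : ∀ᵐ p ∂ν, ∃ i, t i p.1 = p.2) :
    kolSinai T μ = kolSinai (Prod.map T R) ν := by
  refine kolSinai_eq_of_factor hproj hν.measurable hT.measurable (fun _ => rfl) fun k => ?_
  obtain ⟨idx, hidx, hidx'⟩ := exists_measurable_index
    (fun i : Fin K => {p : X × Z | t i p.1 = p.2})
    (fun i => measurableSet_eq_fun ((ht i).comp measurable_fst) measurable_snd)
  have hτ : ∀ i, ∃ τ : X → Fin K, Measurable τ ∧ ∀ x, (∃ j, t j (T x) = R (t i x)) →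
      t (τ x) (T x) = R (t i x) := fun i =>
    exists_measurable_index (fun j : Fin K => {x | t j (T x) = R (t i x)})
      (fun j => measurableSet_eq_fun ((ht j).comp hT.measurable) (hR.comp (ht i)))
  choose τ hτ hτ' using hτ
  let e : (Fin K → Fin k) × (Fin K → Fin K) ≃
    Fin (Fintype.card ((Fin K → Fin k) × (Fin K → Fin K))) := Fintype.equivFin _
  refine ⟨Fintype.card ((Fin K → Fin k) × (Fin K → Fin K)), fun g hg => ?_⟩
  let f : X → (Fin K → Fin k) × (Fin K → Fin K) := fun x =>
    (fun i => g (x, t i x), fun i => τ i x)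
  have hf : Measurable f := (measurable_pi_lambda _ fun i =>
    hg.comp (measurable_id.prodMk (ht i))).prodMk (measurable_pi_lambda _ hτ)
  refine ⟨fun x => e (f x), (measurable_of_finite e).comp hf, ?_⟩
  refine le_trans ?_ (entObsT_comp_injective hT hf e.injective (measurable_of_finite e))
  refine entObsT_le_of_orbitName_le hT hf (Real.logb 2 K) fun n => ?_
  have hname := measurable_orbitName hT.measurable hf n
  have hname' : Measurable fun p : X × Z => orbitName T f n p.1 := hname.comp measurable_fst
  have h1 := entOfObs_prod_le ν hname' hidx
  have h2 := entOfObs_le_logb_card ν hidx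
  rw [entOfObs_comp_of_measurePreserving hproj hname] at h1
  rw [Fintype.card_fin] at h2
  refine le_trans ?_ (h1.trans (add_le_add_right h2 _))
  set S : Set (X × Z) := {p | ∀ m : ℕ, ∃ i, t i ((Prod.map T R)^[m] p).1 = ((Prod.map T R)^[m] p).2}
  have hS : ∀ᵐ p ∂ν, p ∈ S := ae_all_iff.2 fun m =>
    (hν.iterate m).quasiMeasurePreserving.ae hcov
  refine entOfObs_le_of_factors ν (hname'.prodMk hidx) S hS fun p hp q hq hpq => ?_
  rw [Prod.mk.injEq] at hpq
  have hval : ∀ m, m < n → f (T^[m] p.1) = f (T^[m] q.1) := fun m hm =>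
    congrFun hpq.1 ⟨m, hm⟩
  have hstep : ∀ p ∈ S, ∀ m i, t i (T^[m] p.1) = R^[m] p.2 →
      t (τ i (T^[m] p.1)) (T^[m + 1] p.1) = R^[m + 1] p.2 := by
    intro p hp m i hi
    rw [Function.iterate_succ_apply', Function.iterate_succ_apply', ← hi]
    refine hτ' i _ ?_
    obtain ⟨j, hj⟩ := hp (m + 1)
    simp only [Prod.map_iterate, Prod.map_fst, Prod.map_snd] at hj
    rw [Function.iterate_succ_apply', Function.iterate_succ_apply', ← hi] at hj
    exact ⟨j, hj⟩
  have key : ∀ m, m ≤ n → ∃ i, t i (T^[m] p.1) = R^[m] p.2 ∧ t i (T^[m] q.1) = R^[m] q.2 := by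
    intro m
    induction m with
    | zero =>
      refine fun _ => ⟨idx p, hidx' p (hp 0), ?_⟩
      rw [hpq.2]
      exact hidx' q (hq 0)
    | succ m ih =>
      intro hm
      obtain ⟨i, hi, hi'⟩ := ih (by omega)
      have hτe : τ i (T^[m] p.1) = τ i (T^[m] q.1) :=
        congrFun (congrArg Prod.snd (hval m (by omega))) i
      refine ⟨τ i (T^[m] p.1), hstep p hp m i hi, ?_⟩
      rw [hτe]
      exact hstep q hq m i hi'
  funext ⟨m, hm⟩
  obtain ⟨i, hi, hi'⟩ := key m hm.le
  have := congrFun (congrArg Prod.fst (hval m hm)) i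
  simp only [f, hi, hi'] at this
  simp only [orbitName, Prod.map_iterate]
  exact this

/-! ### Pin sequences -/

lemma shift_iterate_apply (n : ℕ) (x : Bin) (m : ℤ) : shift^[n] x m = x (m + n) := by
  induction n generalizing m with
  | zero => simp
  | succ n ih =>
    rw [Function.iterate_succ_apply', shift, ih]
    congr 1
    push_cast
    ring

lemma continuous_shift : Continuous shift :=
  continuous_pi fun n => continuous_apply (n + 1)

/-- The shift as a measurable equivalence. -/
def shiftEquiv : Bin ≃ᵐ Bin where
  toFun := shift
  invFun x n := x (n - 1)
  left_inv x := by funext n; simp [shift]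
  right_inv x := by funext n; simp [shift]
  measurable_toFun := continuous_shift.measurable
  measurable_invFun := (continuous_pi fun n => continuous_apply (n - 1)).measurable

lemma shiftEquiv_symm_iterate_apply (n : ℕ) (x : Bin) (m : ℤ) :
    shiftEquiv.symm^[n] x m = x (m - n) := by
  induction n generalizing m with
  | zero => simp
  | succ n ih =>
    rw [Function.iterate_succ_apply']
    change shiftEquiv.symm^[n] x (m - 1) = _
    rw [ih]
    congr 1
    push_cast
    ring

lemma IsFreeConcat.shift {W : Set (List Bool)} {x : Bin} (h : IsFreeConcat W x) :
    IsFreeConcat W (shift x) := by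
  obtain ⟨t, hmono, hup, hdown, hw⟩ := h
  refine ⟨fun k => t k - 1, fun a b hab => sub_lt_sub_right (hmono hab) 1, fun N => ?_,
    fun N => ?_, fun k => ?_⟩
  · obtain ⟨k, hk⟩ := hup (N + 1)
    exact ⟨k, by dsimp only; omega⟩
  · obtain ⟨k, hk⟩ := hdown N
    exact ⟨k, by dsimp only; omega⟩
  · obtain ⟨w, hwW, hlen, hx⟩ := hw k
    refine ⟨w, hwW, by dsimp only; omega, fun i hi => ?_⟩
    rw [← hx i hi, PhaseTransitions.shift]
    congr 1
    ring

lemma mapsTo_shift_Yset : Set.MapsTo shift Yset Yset := by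
  refine Set.MapsTo.closure (fun x hx => ?_) continuous_shift
  obtain ⟨n, hn⟩ := Set.mem_iUnion.1 hx
  exact Set.mem_iUnion.2 ⟨n, Set.MapsTo.closure (fun y hy => hy.shift) continuous_shift hn⟩

lemma segIn_translate {x y : Bin} {k : ℤ} (h : ∀ m, y m = x (m + k)) (i j : ℤ) (S : Set Bin) :
    SegIn y i j S ↔ SegIn x (i + k) (j + k) S := by
  refine exists_congr fun w => and_congr_right fun _ => ⟨fun hw m h1 h2 => ?_, fun hw m h1 h2 => ?_⟩
  · have := hw (m - k) (by omega) (by omega)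
    rw [h, sub_add_cancel] at this
    rw [← this]
    congr 1
    ring
  · rw [h, ← hw (m + k) (by omega) (by omega)]
    congr 1
    ring

lemma mem_Yset_of_forall_segIn {x : Bin} (h : ∀ N : ℕ, SegIn x (-(N : ℤ)) N Yset) : x ∈ Yset := by
  choose y hy hyx using h
  refine isClosed_closure.mem_of_tendsto (f := fun N => shift^[N] (y N)) (b := atTop) ?_
    (Eventually.of_forall fun N => mapsTo_shift_Yset.iterate N (hy N))
  refine tendsto_pi_nhds.2 fun m => tendsto_const_nhds.congr' ?_
  filter_upwards [eventually_ge_atTop m.natAbs] with N hN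
  rw [shift_iterate_apply, ← hyx N m (by omega) (by omega), sub_neg_eq_add]

lemma isClopen_of_forall_eq_imp {A D : Type*} [TopologicalSpace A] [TopologicalSpace D]
    [DiscreteTopology D] {r : A → D} (hr : Continuous r) {S : Set A}
    (h : ∀ p q, r p = r q → p ∈ S → q ∈ S) : IsClopen S := by
  have : S = r ⁻¹' (r '' S) :=
    Set.Subset.antisymm (Set.subset_preimage_image r S) fun q ⟨p, hp, hpq⟩ => h p q hpq hp
  rw [this]
  exact (isClopen_discrete _).preimage hr

lemma SegIn.congr {x y : Bin} {i j : ℤ} {S : Set Bin} (hx : SegIn x i j S)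
    (h : ∀ m, i ≤ m → m ≤ j → x m = y m) : SegIn y i j S := by
  obtain ⟨w, hw, hwx⟩ := hx
  exact ⟨w, hw, fun m h1 h2 => (hwx m h1 h2).trans (h m h1 h2)⟩

lemma isClopen_segIn (i j : ℤ) (S : Set Bin) : IsClopen {x | SegIn x i j S} := by
  refine isClopen_of_forall_eq_imp (r := fun (x : Bin) (m : Finset.Icc i j) => x m)
    (continuous_pi fun m => continuous_apply _) fun x y hxy hx => ?_
  exact SegIn.congr hx fun m h1 h2 => congrFun hxy ⟨m, Finset.mem_Icc.2 ⟨h1, h2⟩⟩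

lemma isClosed_PinSpace : IsClosed PinSpace := by
  have hclopen : ∀ (i j : ℤ) (v : Bool), IsClopen {p : Bin × Bin | p.2 i = v} := fun i j v =>
    isClopen_of_forall_eq_imp (r := fun p : Bin × Bin => p.2 i)
      ((continuous_apply i).comp continuous_snd) fun p q hpq hp => hpq.symm.trans hp
  have hseg : ∀ i j, IsClopen {p : Bin × Bin | SegIn p.1 i j Yset} := fun i j =>
    (isClopen_segIn i j Yset).preimage continuous_fst
  have hzero : ∀ i j : ℤ, IsOpen {p : Bin × Bin | ∀ k, i < k → k ≤ j → p.2 k = false} := by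
    intro i j
    refine (isClopen_of_forall_eq_imp (S := {p : Bin × Bin | ∀ k, i < k → k ≤ j → p.2 k = false})
      (r := fun (p : Bin × Bin) (m : Finset.Icc i j) => p.2 m)
      (continuous_pi fun m => (continuous_apply _).comp continuous_snd)
      fun p q hpq hp k h1 h2 => ?_).isOpen
    exact (congrFun hpq ⟨k, Finset.mem_Icc.2 ⟨h1.le, h2⟩⟩).symm.trans (hp k h1 h2)
  have : PinSpace = ⋂ (i : ℤ) (j : ℤ) (_ : i < j),
      ({p : Bin × Bin | (∀ k, i < k → k ≤ j → p.2 k = false) → SegIn p.1 i j Yset} ∩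
        {p | p.2 i = true → p.2 j = true → ¬ SegIn p.1 i j Yset}) := by
    ext p
    simp only [PinSpace, Set.mem_iInter, Set.mem_inter_iff, Set.mem_ofPred_eq]
    exact ⟨fun h i j hij => ⟨h.1 i j hij, h.2 i j hij⟩,
      fun h => ⟨fun i j hij => (h i j hij).1, fun i j hij => (h i j hij).2⟩⟩
  rw [this]
  refine isClosed_iInter fun i => isClosed_iInter fun j => isClosed_iInter fun _ => ?_
  exact (isClosed_imp (hzero i j) (hseg i j).isClosed).inter
    (isClosed_imp (hclopen i j true).isOpen
      (isClosed_imp (hclopen j i true).isOpen (hseg i j).compl.isClosed))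

/-- A pin sequence is determined to the right of any of its pins. -/
lemma pin_eq_of_common_pin {x z w : Bin} (hz : (x, z) ∈ PinSpace) (hw : (x, w) ∈ PinSpace)
    {p : ℤ} (hzp : z p = true) (hwp : w p = true) (n : ℕ) : z (p + n) = w (p + n) := by
  have step : ∀ {z w : Bin}, (x, z) ∈ PinSpace → (x, w) ∈ PinSpace → z p = true → ∀ n : ℕ,
      (∀ m ≤ n, z (p + m) = w (p + m)) → z (p + (n + 1 : ℕ)) = true →
      w (p + (n + 1 : ℕ)) = false → False := by
    intro z w hz hw hzp n hagree hz1 hw0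
    classical
    let r := Nat.findGreatest (fun m : ℕ => z (p + m) = true) n
    have hr : z (p + r) = true :=
      Nat.findGreatest_spec (P := fun m : ℕ => z (p + m) = true) (Nat.zero_le n)
        (by simpa using hzp)
    have hrn : r ≤ n := Nat.findGreatest_le n
    refine hz.2 (p + r) (p + (n + 1 : ℕ)) (by omega) hr hz1
      (hw.1 _ _ (by omega) fun k h1 h2 => ?_)
    obtain ⟨m, rfl⟩ : ∃ m : ℕ, k = p + m := ⟨(k - p).toNat, by omega⟩
    rcases (show m ≤ n + 1 by omega).eq_or_lt with rfl | hm
    · exact hw0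
    · change w (p + m) = false
      rw [← hagree m (by omega)]
      exact Bool.eq_false_iff.2 (Nat.findGreatest_is_greatest
        (P := fun m : ℕ => z (p + m) = true) (show r < m by omega) (by omega))
  induction n using Nat.strong_induction_on with
  | _ n ih =>
    cases n with
    | zero => simp [hzp, hwp]
    | succ n =>
      have hagree : ∀ m ≤ n, z (p + m) = w (p + m) := fun m hm => ih m (by omega)
      cases h1 : z (p + (n + 1 : ℕ)) <;> cases h2 : w (p + (n + 1 : ℕ))
      · rfl
      · exact (step hw hz hwp n (fun m hm => (hagree m hm).symm) h2 h1).elim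
      · exact (step hz hw hzp n hagree h1 h2).elim
      · rfl

/-- The points in which a window of radius `N` whose word is not in the language of `Y` occurs
arbitrarily far to the left. -/
def leftRecurrent (N : ℕ) : Set Bin :=
  {x | ∀ M : ℤ, ∃ k ≤ M, ¬ SegIn x (k - N) (k + N) Yset}

lemma card_pinSequences_le {N : ℕ} (hN : 0 < N) {x : Bin} (hx : x ∈ leftRecurrent N)
    (S : Finset Bin) (hS : ∀ z ∈ S, (x, z) ∈ PinSpace) : S.card ≤ 2 * N := by
  classical
  have hsep : ∀ z w : Bin, ∃ a : ℤ, z ≠ w → z a ≠ w a := fun z w => by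
    by_cases h : z = w
    · exact ⟨0, fun h' => absurd h h'⟩
    · obtain ⟨a, ha⟩ := Function.ne_iff.1 h
      exact ⟨a, fun _ => ha⟩
  choose d hd using hsep
  obtain ⟨M, hM⟩ := ((S ×ˢ S).image fun c => -d c.1 c.2).exists_le
  obtain ⟨k, hk, hbad⟩ := hx (-M - N)
  have hpin : ∀ z : Bin, ∃ p : ℤ, z ∈ S → p ∈ Finset.Ioc (k - N) (k + N) ∧ z p = true := by
    intro z
    by_contra! h
    refine hbad ((hS z (h 0).1).1 _ _ (by omega) fun p h1 h2 => ?_)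
    exact Bool.eq_false_iff.2 ((h p).2 (Finset.mem_Ioc.2 ⟨h1, h2⟩))
  choose pin hpin using hpin
  have hinj : Set.InjOn pin S := by
    intro z hz w hw hzw
    by_contra hne
    have hle := hM (-d z w) (Finset.mem_image.2 ⟨(z, w), Finset.mem_product.2 ⟨hz, hw⟩, rfl⟩)
    have hp := Finset.mem_Ioc.1 (hpin z hz).1
    refine hd z w hne ?_
    have := pin_eq_of_common_pin (hS z hz) (hS w hw) (hpin z hz).2
      (by rw [hzw]; exact (hpin w hw).2) (d z w - pin z).toNat
    rwa [show pin z + ((d z w - pin z).toNat : ℤ) = d z w by omega] at this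
  have := Finset.card_le_card_of_injOn pin (fun z hz => (hpin z hz).1) hinj
  rw [Int.card_Ioc] at this
  omega

lemma measurableSet_leftRecurrent (N : ℕ) : MeasurableSet (leftRecurrent N) := by
  simp only [leftRecurrent, Set.ofPred_forall, Set.ofPred_exists, Set.ofPred_and]
  exact MeasurableSet.iInter fun M => MeasurableSet.iUnion fun k =>
    (MeasurableSet.const _).inter (isClopen_segIn _ _ Yset).isOpen.measurableSet.compl

lemma preimage_shift_leftRecurrent (N : ℕ) : shift ⁻¹' leftRecurrent N = leftRecurrent N := by
  have hseg : ∀ (x : Bin) (k : ℤ), SegIn (shift x) (k - N) (k + N) Yset ↔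
      SegIn x (k + 1 - N) (k + 1 + N) Yset := fun x k => by
    rw [segIn_translate (x := x) (y := shift x) (k := 1) (fun _ => rfl) (k - N) (k + N)]
    ring_nf
  ext x
  refine ⟨fun h M => ?_, fun h M => ?_⟩
  · obtain ⟨k, hk, hbad⟩ := h (M - 1)
    exact ⟨k + 1, by omega, by rwa [← hseg]⟩
  · obtain ⟨k, hk, hbad⟩ := h (M + 1)
    exact ⟨k - 1, by omega, by rwa [hseg, sub_add_cancel]⟩

lemma exists_ae_mem_leftRecurrent {μ : Measure Bin} [IsProbabilityMeasure μ]
    (herg : Ergodic shift μ) (hY : μ Yset = 0) :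
    ∃ N : ℕ, 0 < N ∧ ∀ᵐ x ∂μ, x ∈ leftRecurrent N := by
  obtain ⟨N, hN⟩ : ∃ N : ℕ, μ {x | ¬ SegIn x (-(N : ℤ)) N Yset} ≠ 0 := by
    by_contra! h
    have hall : ∀ᵐ x ∂μ, ∀ N : ℕ, SegIn x (-(N : ℤ)) N Yset := ae_all_iff.2 fun N =>
      ae_iff.2 (h N)
    have hnot : ∀ᵐ x ∂μ, x ∉ Yset := measure_eq_zero_iff_ae_notMem.1 hY
    obtain ⟨x, hx, hx'⟩ := (hall.and hnot).exists
    exact hx' (mem_Yset_of_forall_segIn hx)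
  have hmono : ∀ x : Bin, ¬ SegIn x (-(N : ℤ)) N Yset →
      ¬ SegIn x (0 - (N + 1 : ℕ)) (0 + (N + 1 : ℕ)) Yset := by
    rintro x hx ⟨y, hy, hyx⟩
    refine hx ⟨shift y, mapsTo_shift_Yset hy, fun m h1 h2 => ?_⟩
    rw [← hyx m (by omega) (by omega), shift]
    congr 1
    push_cast
    ring
  refine ⟨N + 1, N.succ_pos, ?_⟩
  set B : Set Bin := {x | ¬ SegIn x (0 - (N + 1 : ℕ)) (0 + (N + 1 : ℕ)) Yset}
  have hB : MeasurableSet B := (isClopen_segIn _ _ Yset).isOpen.measurableSet.compl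
  have hBpos : μ B ≠ 0 := fun h => hN (measure_mono_null hmono h)
  have hsymm : MeasurePreserving shiftEquiv.symm μ μ :=
    MeasurePreserving.symm shiftEquiv herg.toMeasurePreserving
  have hrec := hsymm.conservative.ae_mem_imp_frequently_image_mem hB.nullMeasurableSet
  refine (herg.toPreErgodic.ae_mem_or_ae_notMem (measurableSet_leftRecurrent (N + 1))
    (preimage_shift_leftRecurrent (N + 1))).resolve_right fun hnot => hBpos ?_
  refine measure_eq_zero_iff_ae_notMem.2 ?_
  filter_upwards [hrec, hnot] with x hx hx' hxB
  refine hx' fun M => ?_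
  obtain ⟨n, hn, hnB⟩ := (frequently_atTop.1 (hx hxB)) M.natAbs
  refine ⟨-n, by omega, ?_⟩
  have : ¬ SegIn (shiftEquiv.symm^[n] x) (0 - (N + 1 : ℕ)) (0 + (N + 1 : ℕ)) Yset := hnB
  rw [segIn_translate (x := x) (k := -n) fun m => by
    rw [shiftEquiv_symm_iterate_apply, sub_eq_add_neg]] at this
  convert this using 2
  all_goals ring

/-- the projection from the pin space is a.e. finite-to-one and
preserves entropy. -/
theorem pin_projection_entropy (μ : Measure Bin) (hprob : IsProbabilityMeasure μ)
    (herg : Ergodic shift μ) (hY : μ Yset = 0)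
    (ν : Measure (Bin × Bin)) (hνprob : IsProbabilityMeasure ν)
    (hνinv : MeasurePreserving shift2 ν ν) (hνP : ν PinSpace = 1)
    (hproj : ν.map Prod.fst = μ) :
    (∀ᵐ p ∂ν, {q : Bin × Bin | q ∈ PinSpace ∧ q.1 = p.1}.Finite) ∧
    kolSinai shift μ = kolSinai shift2 ν := by
  obtain ⟨N, hN, hrec⟩ := exists_ae_mem_leftRecurrent herg hY
  have hfst : MeasurePreserving Prod.fst ν μ := ⟨measurable_fst, hproj⟩
  have hrec' : ∀ᵐ p ∂ν, p.1 ∈ leftRecurrent N := hfst.quasiMeasurePreserving.ae hrec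
  have hpin : ∀ᵐ p ∂ν, p ∈ PinSpace :=
    (mem_ae_iff_prob_eq_one isClosed_PinSpace.measurableSet).2 hνP
  constructor
  · filter_upwards [hrec'] with p hp
    by_contra hinf
    obtain ⟨S, hS, hcard⟩ := Set.Infinite.exists_subset_card_eq hinf (2 * N + 1)
    classical
    have hle := card_pinSequences_le hN hp (S.image Prod.snd) fun z hz => by
      obtain ⟨q, hq, rfl⟩ := Finset.mem_image.1 hz
      rw [← (hS hq).2]
      exact (hS hq).1
    rw [Finset.card_image_of_injOn fun q hq r hr hqr =>
      Prod.ext ((hS hq).2.trans (hS hr).2.symm) hqr] at hle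
    omega
  · obtain ⟨K, t, ht, hcov⟩ := exists_measurable_sections isClosed_PinSpace.isCompact
      fun x hx S hS => card_pinSequences_le hN hx S hS
    refine kolSinai_eq_of_sections continuous_shift.measurable herg.toMeasurePreserving
      hνinv hfst t ht ?_
    filter_upwards [hrec', hpin] with p hp hpP
    exact hcov p.1 hp p.2 hpP

end PhaseTransitions
end
end
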